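/- Let N ≥ 2 and s ∈ (0,1). For every μ ≥ μ_0 there exist a unique τ_−(s,μ) ∈ (−N, (2s−N)/2] and a unique τ_+(s,μ) ∈ [(2s−N)/2, 2s) such that the functions Φ_μ and Γ_μ belong to L¹(ℝ^N, dx/(1+|x|^{N+2s})) ∩ C^∞(ℝ^N∖{0}) and are classical solutions of (−Δ)^s u + μ |x|^{−2s} u = 0 in ℝ^N∖{0}; that is, for every x ≠ 0 the principal value limit defining (−Δ)^s Φ_μ(x) exists and equals −μ |x|^{−2s} Φ_μ(x), and likewise for Γ_μ. Moreover: the map μ ↦ τ_−(s,μ) is continuous and strictly decreasing on [μ_0,∞), the map μ ↦ τ_+(s,μ) is continuous and strictly increasing on [μ_0,∞); τ_−(s,μ) + τ_+(s,μ) = 2s − N for all μ ≥ μ_0; τ_−(s,μ_0) = τ_+(s,μ_0) = (2s−N)/2, τ_−(s,0) = 2s−N, τ_+(s,0) = 0; and τ_−(s,μ) → −N, τ_+(s,μ) → 2s as μ → +∞. -/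

import Mathlib

open MeasureTheory Filter Set Topology Metric

noncomputable section

/-- Euclidean space `ℝ^N`. -/
abbrev EN (N : ℕ) := EuclideanSpace ℝ (Fin N)

/-- The normalizing constant `C_{N,s}` of the fractional Laplacian. -/
def CNs (N : ℕ) (s : ℝ) : ℝ :=
  2 ^ (2*s) * Real.pi ^ (-(N:ℝ)/2) * s * Real.Gamma ((N + 2*s)/2) / Real.Gamma (1 - s)

/-- The optimal fractional Hardy constant `μ₀`. -/
def mu0 (N : ℕ) (s : ℝ) : ℝ :=
  -(2 ^ (2*s) * Real.Gamma ((N + 2*s)/4) ^ 2 / Real.Gamma ((N - 2*s)/4) ^ 2)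

/-- The function `τ ↦ c_s(τ)`. -/
def csFun (N : ℕ) (s τ : ℝ) : ℝ :=
  2 ^ (2*s) * Real.Gamma ((N + τ)/2) * Real.Gamma ((2*s - τ)/2) /
    (Real.Gamma (-τ/2) * Real.Gamma ((N - 2*s + τ)/2))

/-- `u` has fractional Laplacian `(-Δ)^s u (x) = L` at `x`, as a principal value. -/
def HasFracLap (N : ℕ) (s : ℝ) (u : EN N → ℝ) (x : EN N) (L : ℝ) : Prop :=
  Tendsto (fun ε : ℝ =>
      CNs N s * ∫ z in {z : EN N | ε ≤ dist x z}, (u x - u z) / dist x z ^ ((N:ℝ) + 2*s))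
    (𝓝[>] 0) (𝓝 L)

/-- `v` has weighted fractional Laplacian `(-Δ)^s_{Γ_μ} v (x) = L` at `x`, where the weight
is `Γ_μ(z) = ‖z‖ ^ τp` with `τp = τ₊(s,μ)`. -/
def HasWFracLap (N : ℕ) (s τp : ℝ) (v : EN N → ℝ) (x : EN N) (L : ℝ) : Prop :=
  Tendsto (fun ε : ℝ =>
      CNs N s * ∫ z in {z : EN N | ε ≤ dist x z},
        (v x - v z) * ‖z‖ ^ τp / dist x z ^ ((N:ℝ) + 2*s))
    (𝓝[>] 0) (𝓝 L)

/-- Membership in `L¹(ℝ^N, dx/(1+|x|^{N+2s}))`. -/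
def MemL1w (N : ℕ) (s : ℝ) (u : EN N → ℝ) : Prop :=
  Integrable (fun x : EN N => u x / (1 + ‖x‖ ^ ((N:ℝ) + 2*s)))

/-- Membership in `L^∞_loc(ℝ^N \ {0})`. -/
def LocBddAway (N : ℕ) (u : EN N → ℝ) : Prop :=
  ∀ K : Set (EN N), IsCompact K → (0:EN N) ∉ K → ∃ C : ℝ, ∀ x ∈ K, |u x| ≤ C

/-- Local `θ`-Hölder continuity on compact subsets of `S`, i.e. `C^θ_loc(S)`. -/
def HolderLocOn (N : ℕ) (θ : ℝ) (f : EN N → ℝ) (S : Set (EN N)) : Prop :=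
  ∀ K ⊆ S, IsCompact K → ∃ C : ℝ, ∀ x ∈ K, ∀ y ∈ K, |f x - f y| ≤ C * dist x y ^ θ

/-- Membership in `L^∞_loc(S)`. -/
def LinfLocOn (N : ℕ) (f : EN N → ℝ) (S : Set (EN N)) : Prop :=
  AEMeasurable f ∧ ∀ K ⊆ S, IsCompact K → ∃ C : ℝ, ∀ x ∈ K, |f x| ≤ C

/-- A bounded `C²` domain: open, connected and bounded, whose boundary is the regular zero
level set of a `C²` defining function. -/
structure IsBoundedC2Domain (N : ℕ) (Ω : Set (EN N)) : Prop where
  isOpen : IsOpen Ω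
  isConnected : IsConnected Ω
  isBounded : Bornology.IsBounded Ω
  c2Boundary : ∃ φ : EN N → ℝ, ContDiff ℝ 2 φ ∧ Ω = {x | φ x < 0} ∧
    ∀ x ∈ frontier Ω, fderiv ℝ φ x ≠ 0

/-- A bounded domain: open, connected and bounded. -/
def IsBoundedDomain (N : ℕ) (Ω : Set (EN N)) : Prop :=
  IsOpen Ω ∧ IsConnected Ω ∧ Bornology.IsBounded Ω

/-- The first standard coordinate vector `e₁ ∈ ℝ^N`. -/
def e1 (N : ℕ) : EN N :=
  (EuclideanSpace.equiv (Fin N) ℝ).symm (fun i => if (i:ℕ) = 0 then 1 else 0)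

/-- The surface measure `ω_{N-1}` of the unit sphere in `ℝ^N`. -/
def omegaN (N : ℕ) : ℝ := N * (volume (ball (0 : EN N) 1)).toReal

/-- The normalization constant `c_{s,0}`. -/
def cs0 (N : ℕ) (s : ℝ) : ℝ :=
  CNs N s * omegaN N * ∫ t in Ioo (0:ℝ) 1, ∫ z in ball (0:EN N) t,
    (‖z‖ ^ (2*s - N) - 1) / ‖e1 N - z‖ ^ ((N:ℝ) + 2*s)

/-- The fundamental solution `Φ_μ`, expressed via the exponent `τ = τ₋(s,μ)`:
`Φ_μ(x) = |x|^τ` for `μ ≠ μ₀` and `Φ_{μ₀}(x) = -|x|^τ ln |x|`. -/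
def Phi (N : ℕ) (s μ τ : ℝ) (x : EN N) : ℝ :=
  if μ = mu0 N s then -(‖x‖ ^ τ * Real.log ‖x‖) else ‖x‖ ^ τ

/-- The integrand appearing in the definition of `c_{s,μ}`. -/
def cIntegrand (N : ℕ) (s μ τm τp : ℝ) (z : EN N) : ℝ :=
  if μ = mu0 N s then ‖z‖ ^ ((2*s - N)/2) * (-Real.log ‖z‖) / ‖e1 N - z‖ ^ ((N:ℝ) + 2*s)
  else (‖z‖ ^ τm - ‖z‖ ^ τp) / ‖e1 N - z‖ ^ ((N:ℝ) + 2*s)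

/-- The normalization constant `c_{s,μ}`. -/
def csmu (N : ℕ) (s μ τm τp : ℝ) : ℝ :=
  CNs N s * omegaN N * ∫ t in Ioo (0:ℝ) 1, ∫ z in ball (0:EN N) t, cIntegrand N s μ τm τp z

/-- The weight `Λ_μ`, expressed via `τp = τ₊(s,μ)`. -/
def Lam (N : ℕ) (s τp : ℝ) (x : EN N) : ℝ :=
  if 2*s - 1 < τp then 1
  else if τp < 2*s - 1 then ‖x‖ ^ (1 - 2*s + τp)
  else 1 + max (-Real.log ‖x‖) 0

/-- The quadratic form `E^s(u,v)`. -/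
def Es (N : ℕ) (s : ℝ) (u v : EN N → ℝ) : ℝ :=
  (CNs N s / 2) *
    ∫ p : EN N × EN N, (u p.1 - u p.2) * (v p.1 - v p.2) / dist p.1 p.2 ^ ((N:ℝ) + 2*s)

/-- The quadratic form `E^s_μ(u,v)`. -/
def Esmu (N : ℕ) (s μ : ℝ) (u v : EN N → ℝ) : ℝ :=
  Es N s u v + μ * ∫ x : EN N, u x * v x / ‖x‖ ^ (2*s)

/-- `E^s_{A,B}(u,u) < ∞`. -/
def FiniteEnergyOn (N : ℕ) (s : ℝ) (u : EN N → ℝ) (A B : Set (EN N)) : Prop :=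
  IntegrableOn (fun p : EN N × EN N => (u p.1 - u p.2)^2 / dist p.1 p.2 ^ ((N:ℝ) + 2*s)) (A ×ˢ B)

/-- Membership in `H^s(ℝ^N)`: locally `L²` with finite Gagliardo seminorm. -/
def MemHs (N : ℕ) (s : ℝ) (u : EN N → ℝ) : Prop :=
  (∀ K : Set (EN N), IsCompact K → IntegrableOn (fun x => (u x)^2) K) ∧
  FiniteEnergyOn N s u univ univ

/-- Membership in `H^s_0(Ω)`. -/
def MemHs0 (N : ℕ) (s : ℝ) (Ω : Set (EN N)) (u : EN N → ℝ) : Prop :=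
  MemHs N s u ∧ ∀ᵐ x : EN N, x ∉ Ω → u x = 0

/-- Membership in `W^s(Ω)`. -/
def MemWs (N : ℕ) (s : ℝ) (Ω : Set (EN N)) (u : EN N → ℝ) : Prop :=
  MemL1w N s u ∧ IntegrableOn (fun x => (u x)^2) Ω ∧
  ∃ Ω' : Set (EN N), IsOpen Ω' ∧ IsConnected Ω' ∧ closure Ω ⊆ Ω' ∧ FiniteEnergyOn N s u Ω Ω'

/-- Membership in `W^s_*(Ω)`. -/
def MemWsStar (N : ℕ) (s : ℝ) (Ω : Set (EN N)) (u : EN N → ℝ) : Prop :=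
  MemL1w N s u ∧ ∀ ε : ℝ, 0 < ε → MemWs N s (Ω \ closedBall 0 ε) u

/-- The distributional identity `L^s_μ u = f` in `Ω \ {0}`, tested against `C^∞_c(Ω\{0})`. -/
def DistrEq (N : ℕ) (s μ : ℝ) (Ω : Set (EN N)) (f u : EN N → ℝ) : Prop :=
  ∀ φ : EN N → ℝ, ContDiff ℝ (⊤ : ℕ∞) φ → HasCompactSupport φ → tsupport φ ⊆ Ω \ {0} →
    ∀ g : EN N → ℝ, (∀ x, HasFracLap N s φ x (g x)) →
      (∫ x, u x * g x) + μ * ∫ x, u x * φ x / ‖x‖ ^ (2*s) = ∫ x in Ω, f x * φ x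

/-- A distributional solution of `L^s_μ u = f` in `Ω \ {0}` with `u = 0` in `ℝ^N \ Ω`. -/
def IsDistrSol (N : ℕ) (s μ : ℝ) (Ω : Set (EN N)) (f u : EN N → ℝ) : Prop :=
  LocBddAway N u ∧ MemL1w N s u ∧ (∀ x ∉ Ω, u x = 0) ∧ DistrEq N s μ Ω f u



lemma lip_rpow (σ : ℝ) : ∃ K : ℝ, 0 ≤ K ∧ ∀ x ∈ Icc (1/20:ℝ) 20, ∀ y ∈ Icc (1/20:ℝ) 20,
    |x ^ σ - y ^ σ| ≤ K * |x - y| := by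
  have h : ContDiffOn ℝ 1 (fun x : ℝ => x ^ σ) (Icc (1/20:ℝ) 20) := by
    intro x hx
    exact (Real.contDiffAt_rpow_const_of_ne (by linarith [hx.1] : x ≠ 0)).contDiffWithinAt
  obtain ⟨K, hK⟩ := h.exists_lipschitzOnWith one_ne_zero (convex_Icc _ _) isCompact_Icc
  refine ⟨K, K.2, fun x hx y hy => ?_⟩
  have := hK.dist_le_mul x hx y hy
  simpa [Real.dist_eq] using this

lemma lip_rpow_one (σ : ℝ) : ∃ K : ℝ, 0 ≤ K ∧ ∀ x ∈ Icc (1/20:ℝ) 20, |1 - x ^ σ| ≤ K * |1 - x| := by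
  obtain ⟨K, hK, h⟩ := lip_rpow σ
  refine ⟨K, hK, fun x hx => ?_⟩
  simpa using h 1 (by norm_num) x hx

lemma abs_log_le_near {x : ℝ} (hx : x ∈ Icc (1/20:ℝ) 20) : |Real.log x| ≤ 20 * |1 - x| := by
  have h0 : 0 < x := by linarith [hx.1]
  have h1 := Real.log_le_sub_one_of_pos h0
  have h2 := Real.one_sub_inv_le_log_of_pos h0
  have h3 : 1 - x⁻¹ = x⁻¹ * (x - 1) := by field_simp
  have h4 : x⁻¹ ≤ 20 := by
    rw [inv_le_comm₀ h0 (by norm_num)]; linarith [hx.1]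
  have h5 : 0 < x⁻¹ := by positivity
  rw [abs_le]
  constructor
  · rcases le_total 1 x with h | h
    · have : 0 ≤ x⁻¹ * (x-1) := mul_nonneg h5.le (by linarith)
      have := abs_nonneg (1-x)
      linarith
    · rw [abs_of_nonneg (by linarith)]
      nlinarith
  · rcases le_total 1 x with h | h
    · rw [abs_of_nonpos (by linarith)]; linarith
    · have := abs_nonneg (1-x); linarith

lemma abs_log_le_rpow {η r : ℝ} (hη : 0 < η) (hr : 0 < r) :
    |Real.log r| ≤ (r ^ η + r ^ (-η)) / η := by
  have h1 := Real.log_le_rpow_div hr.le hη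
  have h2 := Real.log_le_rpow_div (inv_pos.2 hr).le hη
  rw [Real.log_inv, Real.inv_rpow hr.le, ← Real.rpow_neg hr.le] at h2
  have h3 : 0 ≤ r ^ η / η := by positivity
  have h4 : 0 ≤ r ^ (-η) / η := by positivity
  rw [add_div, abs_le]; constructor <;> linarith

/-- radial profile `r^τ (p + q log r)` -/
def fpq (τ p q r : ℝ) : ℝ := r ^ τ * (p + q * Real.log r)

lemma one_le_rpow_add {η r : ℝ} (hη : 0 < η) (hr : 0 < r) : 1 ≤ r ^ η + r ^ (-η) := by
  rcases le_total 1 r with h | h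
  · have := Real.one_le_rpow h hη.le
    have : 0 < r ^ (-η) := by positivity
    linarith
  · have := Real.one_le_rpow_of_pos_of_le_one_of_nonpos hr h (by linarith : -η ≤ 0)
    have : 0 < r ^ η := by positivity
    linarith

lemma fpq_bound (τ p q : ℝ) {η r : ℝ} (hη : 0 < η) (hr : 0 < r) :
    |fpq τ p q r| ≤ (|p| + |q| / η) * (r ^ (τ + η) + r ^ (τ - η)) := by
  unfold fpq
  have h1 := abs_log_le_rpow hη hr
  have h2 := one_le_rpow_add hη hr
  rw [abs_mul, abs_of_pos (by positivity : 0 < r ^ τ), sub_eq_add_neg, Real.rpow_add hr, Real.rpow_add hr]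
  have h3 : |p + q * Real.log r| ≤ (|p| + |q| / η) * (r ^ η + r ^ (-η)) := by
    calc _ ≤ |p| + |q| * |Real.log r| := by
          rw [← abs_mul]; exact abs_add_le _ _
      _ ≤ |p| * (r ^ η + r ^ (-η)) + |q| * ((r ^ η + r ^ (-η)) / η) := by
          gcongr
          exact le_mul_of_one_le_right (abs_nonneg _) h2
      _ = _ := by ring
  calc _ ≤ r ^ τ * ((|p| + |q| / η) * (r ^ η + r ^ (-η))) := by gcongr
    _ = _ := by ring

lemma fpq_measurable (τ p q : ℝ) : Measurable (fpq τ p q) := by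
  unfold fpq
  fun_prop

lemma rpow_integrableOn_ball (N : ℕ) (hN : 2 ≤ N) {τ : ℝ} (hτ : -(N:ℝ) < τ) (R : ℝ) :
    IntegrableOn (fun x : EN N => ‖x‖ ^ τ) (ball 0 R) := by
  have : Nontrivial (EN N) := by
    have : Nonempty (Fin N) := ⟨⟨0, by omega⟩⟩
    infer_instance
  have key := integrableOn_fun_norm_addHaar (volume : Measure (EN N)) (f := fun r : ℝ => r ^ τ) (r := R)
  rw [key]
  rcases le_total R 0 with h | h
  · simp [Ioo_eq_empty (not_lt.2 h)]
  rw [← intervalIntegrable_iff_integrableOn_Ioo_of_le h]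
  have := intervalIntegral.intervalIntegrable_rpow' (a := 0) (b := R) (r := (N:ℝ) - 1 + τ) (by linarith)
  refine this.congr ?_
  intro r hr
  rw [uIoc_of_le h] at hr
  simp only [finrank_euclideanSpace, Fintype.card_fin, smul_eq_mul]
  rw [Real.rpow_add hr.1, ← Real.rpow_natCast, Nat.cast_sub (by omega)]
  simp

lemma rpow_memL1w (N : ℕ) (hN : 2 ≤ N) (s : ℝ) (hs : s ∈ Ioo (0:ℝ) 1) {τ : ℝ}
    (hτ : τ ∈ Ioo (-(N:ℝ)) (2*s)) : MemL1w N s (fun x => ‖x‖ ^ τ) := by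
  have : Nontrivial (EN N) := by
    have : Nonempty (Fin N) := ⟨⟨0, by omega⟩⟩
    infer_instance
  unfold MemL1w
  rw [integrable_fun_norm_addHaar (volume : Measure (EN N))
    (f := fun r : ℝ => r ^ τ / (1 + r ^ ((N:ℝ) + 2*s)))]
  have hN1 : ((N - 1 : ℕ) : ℝ) = (N:ℝ) - 1 := by rw [Nat.cast_sub (by omega)]; simp
  have e : ∀ r ∈ Ioi (0:ℝ), r ^ (Module.finrank ℝ (EN N) - 1) • (r ^ τ / (1 + r ^ ((N:ℝ) + 2*s)))
     = r ^ ((N:ℝ) - 1 + τ) / (1 + r ^ ((N:ℝ) + 2*s)) := by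
    intro r hr
    simp only [finrank_euclideanSpace, Fintype.card_fin, smul_eq_mul]
    rw [Real.rpow_add hr ((N:ℝ)-1) τ, ← hN1, Real.rpow_natCast]; ring
  rw [integrableOn_congr_fun e measurableSet_Ioi]
  have hm : ∀ S : Set ℝ, AEStronglyMeasurable
      (fun r : ℝ => r ^ ((N:ℝ) - 1 + τ) / (1 + r ^ ((N:ℝ) + 2*s))) (volume.restrict S) := by
    intro S
    apply Measurable.aestronglyMeasurable
    fun_prop
  rw [← Ioc_union_Ioi_eq_Ioi zero_le_one]
  apply IntegrableOn.union
  · have h1 := intervalIntegral.intervalIntegrable_rpow' (a := 0) (b := 1) (r := (N:ℝ) - 1 + τ) (by linarith [hτ.1])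
    rw [intervalIntegrable_iff_integrableOn_Ioc_of_le zero_le_one] at h1
    refine Integrable.mono' h1 (hm _) ?_
    filter_upwards [ae_restrict_mem measurableSet_Ioc] with r hr
    have h0 := hr.1
    rw [Real.norm_of_nonneg (by positivity)]
    apply div_le_self (by positivity)
    have : 0 < r ^ ((N:ℝ) + 2*s) := by positivity
    linarith
  · have h1 := integrableOn_Ioi_rpow_of_lt (a := τ - 2*s - 1) (c := 1) (by linarith [hτ.2]) one_pos
    refine Integrable.mono' h1 (hm _) ?_
    filter_upwards [ae_restrict_mem measurableSet_Ioi] with r hr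
    have h0 : 0 < r := lt_trans one_pos hr
    rw [Real.norm_of_nonneg (by positivity), div_le_iff₀ (by positivity)]
    have : r ^ ((N:ℝ) - 1 + τ) = r ^ (τ - 2*s - 1) * r ^ ((N:ℝ) + 2*s) := by
      rw [← Real.rpow_add h0]; ring_nf
    rw [this]
    gcongr
    linarith

lemma ae_ne_zero (N : ℕ) (hN : 2 ≤ N) : ∀ᵐ x : EN N, x ≠ 0 := by
  have : Nontrivial (EN N) := by
    have : Nonempty (Fin N) := ⟨⟨0, by omega⟩⟩
    infer_instance
  exact Measure.ae_ne volume 0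

lemma exists_eta {N : ℕ} {s τ : ℝ} (hτ : τ ∈ Ioo (-(N:ℝ)) (2*s)) :
    ∃ η : ℝ, 0 < η ∧ τ + η ∈ Ioo (-(N:ℝ)) (2*s) ∧ τ - η ∈ Ioo (-(N:ℝ)) (2*s) := by
  have h1 := hτ.1
  have h2 := hτ.2
  refine ⟨min (τ + N) (2*s - τ) / 2, ?_, ?_, ?_⟩
  · have : 0 < min (τ + N) (2*s - τ) := lt_min (by linarith) (by linarith)
    linarith
  all_goals
    have : 0 < min (τ + N) (2*s - τ) := lt_min (by linarith) (by linarith)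
    have := min_le_left (τ + N) (2*s - τ)
    have := min_le_right (τ + N) (2*s - τ)
    constructor <;> linarith

lemma fpq_memL1w (N : ℕ) (hN : 2 ≤ N) (s : ℝ) (hs : s ∈ Ioo (0:ℝ) 1) {τ : ℝ}
    (hτ : τ ∈ Ioo (-(N:ℝ)) (2*s)) (p q : ℝ) : MemL1w N s (fun x => fpq τ p q ‖x‖) := by
  obtain ⟨η, hη, h1, h2⟩ := exists_eta hτ
  have := ((rpow_memL1w N hN s hs h1).add (rpow_memL1w N hN s hs h2)).const_mul (|p| + |q| / η)
  refine Integrable.mono' this ?_ ?_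
  · apply Measurable.aestronglyMeasurable
    have := fpq_measurable τ p q
    fun_prop
  · filter_upwards [ae_ne_zero N hN] with x hx
    have hx' : 0 < ‖x‖ := norm_pos_iff.2 hx
    have := fpq_bound τ p q hη hx'
    rw [norm_div, Real.norm_eq_abs, Real.norm_of_nonneg (by positivity : 0 ≤ 1 + ‖x‖ ^ ((N:ℝ) + 2*s))]
    simp only [Pi.add_apply]
    rw [← add_div, ← mul_div_assoc]
    gcongr


/-- inversion in the unit sphere -/
def Jinv (N : ℕ) : EN N → EN N := EuclideanGeometry.inversion (0 : EN N) 1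

lemma Jinv_Jinv (N : ℕ) (z : EN N) : Jinv N (Jinv N z) = z :=
  EuclideanGeometry.inversion_inversion _ one_ne_zero _

lemma norm_Jinv (N : ℕ) (z : EN N) : ‖Jinv N z‖ = ‖z‖⁻¹ := by
  have := EuclideanGeometry.dist_inversion_center (0 : EN N) z 1
  simpa [Jinv] using this

lemma Jinv_ne_zero (N : ℕ) {z : EN N} (hz : z ≠ 0) : Jinv N z ≠ 0 := by
  rw [← norm_pos_iff, norm_Jinv]; exact inv_pos.2 (norm_pos_iff.2 hz)

lemma dist_Jinv (N : ℕ) {e z : EN N} (he : ‖e‖ = 1) (hz : z ≠ 0) :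
    dist e (Jinv N z) = dist e z / ‖z‖ := by
  have h1 : EuclideanGeometry.inversion (0 : EN N) 1 e = e :=
    EuclideanGeometry.inversion_of_mem_sphere (by simp [he])
  have he0 : e ≠ 0 := by rw [← norm_pos_iff, he]; exact one_pos
  have := EuclideanGeometry.dist_inversion_inversion he0 hz 1
  rw [h1] at this
  rw [Jinv, this]
  simp [he]; ring

/-- the part of the unit ball corresponding to `{|e - z| ≥ ε, |z| > 1}` -/
def JS (N : ℕ) (e : EN N) (ε : ℝ) : Set (EN N) :=
  {z | ‖z‖ < 1 ∧ z ≠ 0 ∧ ε * ‖z‖ ≤ dist e z}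

lemma JS_meas (N : ℕ) (e : EN N) (ε : ℝ) : MeasurableSet (JS N e ε) := by
  have h1 : MeasurableSet {z : EN N | ‖z‖ < 1} := measurableSet_lt measurable_norm measurable_const
  have h2 : MeasurableSet {z : EN N | z ≠ 0} := (measurableSet_singleton 0).compl
  have h3 : MeasurableSet {z : EN N | ε * ‖z‖ ≤ dist e z} :=
    measurableSet_le (measurable_norm.const_mul ε) (by fun_prop)
  exact h1.inter (h2.inter h3)

lemma JS_image (N : ℕ) {e : EN N} (he : ‖e‖ = 1) (ε : ℝ) :
    Jinv N '' (JS N e ε) = {z | ε ≤ dist e z} ∩ {z | 1 < ‖z‖} := by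
  ext z
  constructor
  · rintro ⟨w, ⟨h1, h2, h3⟩, rfl⟩
    have hw : 0 < ‖w‖ := norm_pos_iff.2 h2
    refine ⟨?_, ?_⟩
    · simp only [mem_ofPred_eq]
      rw [dist_Jinv N he h2, le_div_iff₀ hw]; exact h3
    · simp only [mem_ofPred_eq]
      rw [norm_Jinv]; exact (one_lt_inv₀ hw).2 h1
  · rintro ⟨h1, h2⟩
    simp only [mem_ofPred_eq] at h1 h2
    have hz : z ≠ 0 := by rw [← norm_pos_iff]; linarith
    refine ⟨Jinv N z, ⟨?_, Jinv_ne_zero N hz, ?_⟩, Jinv_Jinv N z⟩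
    · rw [norm_Jinv]; exact inv_lt_one_of_one_lt₀ h2
    · rw [dist_Jinv N he hz, norm_Jinv, ← div_eq_mul_inv]
      gcongr

lemma JS_fderiv (N : ℕ) (e : EN N) (ε : ℝ) : ∀ z ∈ JS N e ε, HasFDerivWithinAt (Jinv N)
    ((1 / dist z (0:EN N)) ^ 2 • (((ℝ ∙ (z - 0))ᗮ.reflection : EN N ≃L[ℝ] EN N) : EN N →L[ℝ] EN N))
    (JS N e ε) z := by
  intro z hz
  exact (EuclideanGeometry.hasFDerivAt_inversion hz.2.1).hasFDerivWithinAt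

lemma JS_det (N : ℕ) (z : EN N) :
    |((1 / dist z (0:EN N)) ^ 2 • (((ℝ ∙ (z - 0))ᗮ.reflection : EN N ≃L[ℝ] EN N) : EN N →L[ℝ] EN N)).det|
      = (‖z‖ ^ (2*N))⁻¹ := by
  unfold ContinuousLinearMap.det
  rw [ContinuousLinearMap.toLinearMap_smul, LinearMap.det_smul]
  have h := Submodule.det_reflection (𝕜 := ℝ) ((ℝ ∙ (z - 0))ᗮ)
  have h2 : LinearMap.det (((((ℝ ∙ (z - 0))ᗮ.reflection : EN N ≃L[ℝ] EN N) : EN N →L[ℝ] EN N)) : EN N →ₗ[ℝ] EN N)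
     = (-1) ^ Module.finrank ℝ ((ℝ ∙ (z - 0))ᗮᗮ : Submodule ℝ (EN N)) := h
  rw [h2, abs_mul, abs_pow, abs_pow (-1:ℝ)]
  simp [← pow_mul]

lemma inj_JS (N : ℕ) (S : Set (EN N)) : InjOn (Jinv N) S := by
  intro x _ y _ h
  have := congrArg (Jinv N) h
  rwa [Jinv_Jinv, Jinv_Jinv] at this

def Fker (N : ℕ) (s : ℝ) (f : ℝ → ℝ) (e z : EN N) : ℝ :=
  (f 1 - f ‖z‖) / dist e z ^ ((N:ℝ) + 2*s)

def Ftil (N : ℕ) (s : ℝ) (f : ℝ → ℝ) (e z : EN N) : ℝ :=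
  ‖z‖ ^ (2*s - N) * (f 1 - f (‖z‖⁻¹)) / dist e z ^ ((N:ℝ) + 2*s)

lemma Fker_Jinv (N : ℕ) (s : ℝ) (f : ℝ → ℝ) {e z : EN N} (he : ‖e‖ = 1) (hz : z ≠ 0) :
    (‖z‖ ^ (2*N))⁻¹ * Fker N s f e (Jinv N z) = Ftil N s f e z := by
  have hz' : 0 < ‖z‖ := norm_pos_iff.2 hz
  unfold Fker Ftil
  rw [norm_Jinv, dist_Jinv N he hz, Real.div_rpow dist_nonneg hz'.le, div_div_eq_mul_div,
    ← mul_div_assoc]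
  congr 1
  have : ‖z‖ ^ (2*s - N) = (‖z‖ ^ (2*N))⁻¹ * ‖z‖ ^ ((N:ℝ) + 2*s) := by
    rw [← Real.rpow_natCast, ← Real.rpow_neg hz'.le, ← Real.rpow_add hz']
    congr 1; push_cast; ring
  rw [this]; ring

lemma fold_integrable (N : ℕ) (s : ℝ) (f : ℝ → ℝ) {e : EN N} (he : ‖e‖ = 1) (ε : ℝ) :
    IntegrableOn (Fker N s f e) ({z | ε ≤ dist e z} ∩ {z | 1 < ‖z‖}) ↔
      IntegrableOn (Ftil N s f e) (JS N e ε) := by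
  rw [← JS_image N he, integrableOn_image_iff_integrableOn_abs_det_fderiv_smul volume
    (JS_meas N e ε) (JS_fderiv N e ε) (inj_JS N _)]
  apply integrableOn_congr_fun _ (JS_meas N e ε)
  intro z hz
  simp only []
  rw [JS_det, smul_eq_mul, Fker_Jinv N s f he hz.2.1]

lemma fold_integral (N : ℕ) (s : ℝ) (f : ℝ → ℝ) {e : EN N} (he : ‖e‖ = 1) (ε : ℝ) :
    ∫ z in ({z | ε ≤ dist e z} ∩ {z | 1 < ‖z‖}), Fker N s f e z = ∫ z in JS N e ε, Ftil N s f e z := by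
  rw [← JS_image N he, integral_image_eq_integral_abs_det_fderiv_smul volume
    (JS_meas N e ε) (JS_fderiv N e ε) (inj_JS N _)]
  apply setIntegral_congr_fun (JS_meas N e ε)
  intro z hz
  simp only []
  rw [JS_det, smul_eq_mul, Fker_Jinv N s f he hz.2.1]


lemma Aset_meas (N : ℕ) (e : EN N) (ε : ℝ) : MeasurableSet {z : EN N | ε ≤ dist e z} :=
  measurableSet_le measurable_const (by fun_prop)

lemma EN_nontrivial (N : ℕ) (hN : 2 ≤ N) : Nontrivial (EN N) := by
  have : Nonempty (Fin N) := ⟨⟨0, by omega⟩⟩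
  infer_instance

lemma mismatch_volume (N : ℕ) (hN : 2 ≤ N) (e : EN N) {ε : ℝ} (h0 : 0 < ε) (h1 : ε ≤ 1/2) :
    volume.real (ball e ε \ ball e (ε * (1 - ε))) ≤
      volume.real (ball (0:EN N) 1) * N * ε ^ (N+1) := by
  have := EN_nontrivial N hN
  have h2 : 0 < ε * (1 - ε) := by nlinarith
  have h3 : ε * (1-ε) ≤ ε := by nlinarith
  rw [measureReal_sdiff (ball_subset_ball h3) measurableSet_ball (measure_ball_lt_top.ne)]
  rw [measureReal_def, measureReal_def, measureReal_def, Measure.addHaar_ball _ _ h0.le, Measure.addHaar_ball _ _ h2.le]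
  rw [ENNReal.toReal_mul, ENNReal.toReal_mul, ENNReal.toReal_ofReal (by positivity),
    ENNReal.toReal_ofReal (by positivity)]
  simp only [finrank_euclideanSpace, Fintype.card_fin]
  have hB : 1 + (N:ℝ) * (-ε) ≤ (1 + -ε) ^ N := one_add_mul_le_pow (by linarith) N
  set V := (volume (ball (0:EN N) 1)).toReal
  have hV : 0 ≤ V := ENNReal.toReal_nonneg
  rw [mul_pow]
  have : ε ^ N * V - ε ^ N * (1 - ε) ^ N * V = V * ε ^ N * (1 - (1 + -ε)^N) := by ring_nf
  rw [this, pow_succ]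
  calc _ ≤ V * ε ^ N * (N * ε) := by gcongr; linarith
    _ = _ := by ring

lemma mismatch_bound (N : ℕ) (hN : 2 ≤ N) (s : ℝ) (hs : s ∈ Ioo (0:ℝ) 1) (f : ℝ → ℝ) {e : EN N}
    (he : ‖e‖ = 1) {K : ℝ} (hK0 : 0 ≤ K) (hK : ∀ r ∈ Icc (1/20:ℝ) 20, |f 1 - f r| ≤ K * |1 - r|)
    {ε : ℝ} (h0 : 0 < ε) (h1 : ε ≤ 1/2) :
    |∫ z in JS N e ε \ {z | ε ≤ dist e z}, Ftil N s f e z| ≤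
      (2 ^ (N:ℝ) * (K * 2) * 2 ^ ((N:ℝ) + 2*s) * volume.real (ball (0:EN N) 1) * N) * ε ^ (2 - 2*s) := by
  have hsub : JS N e ε \ {z | ε ≤ dist e z} ⊆ ball e ε \ ball e (ε * (1 - ε)) := by
    rintro z ⟨⟨a1, a2, a3⟩, a4⟩
    simp only [mem_ofPred_eq, not_le] at a4
    have : ‖e‖ ≤ ‖z‖ + dist e z := by
      rw [dist_eq_norm]; calc ‖e‖ = ‖z + (e - z)‖ := by congr 1; abel
        _ ≤ _ := norm_add_le _ _
    rw [he] at this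
    refine ⟨by rw [mem_ball, dist_comm]; exact a4, ?_⟩
    rw [mem_ball, dist_comm, not_lt]
    refine le_trans ?_ a3
    gcongr; linarith
  have hfin : volume (JS N e ε \ {z | ε ≤ dist e z}) < ⊤ :=
    lt_of_le_of_lt (measure_mono (hsub.trans sdiff_subset)) measure_ball_lt_top
  have hC : ∀ z ∈ JS N e ε \ {z | ε ≤ dist e z}, ‖Ftil N s f e z‖ ≤
      2 ^ (N:ℝ) * (K * (2 * ε)) / (ε / 2) ^ ((N:ℝ) + 2*s) := by
    intro z hz
    have hz2 := hsub hz
    have b1 : dist e z < ε := by rw [dist_comm]; exact hz2.1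
    have b2 : ε * (1 - ε) ≤ dist e z := by rw [dist_comm]; exact not_lt.1 hz2.2
    have b3 : ε / 2 ≤ dist e z := by nlinarith
    have b4 : ‖z‖ < 1 := hz.1.1
    have : ‖e‖ ≤ ‖z‖ + dist e z := by
      rw [dist_eq_norm]; calc ‖e‖ = ‖z + (e - z)‖ := by congr 1; abel
        _ ≤ _ := norm_add_le _ _
    rw [he] at this
    have b5 : 1/2 ≤ ‖z‖ := by linarith
    have b6 : 0 < ‖z‖ := by linarith
    have b7 : ‖z‖⁻¹ ≤ 2 := by rw [inv_le_comm₀ b6 (by norm_num)]; linarith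
    have b8 : 1 < ‖z‖⁻¹ := (one_lt_inv₀ b6).2 b4
    have b9 := hK ‖z‖⁻¹ ⟨by linarith, by linarith⟩
    have b10 : |1 - ‖z‖⁻¹| ≤ 2 * ε := by
      rw [abs_of_nonpos (by linarith)]
      have : ‖z‖⁻¹ - 1 = ‖z‖⁻¹ * (1 - ‖z‖) := by field_simp
      have h3 : 0 ≤ 1 - ‖z‖ := by linarith
      nlinarith
    have b11 : ‖z‖ ^ (2*s - N) ≤ 2 ^ (N:ℝ) := by
      have hN' : (2:ℝ) ≤ N := by exact_mod_cast hN
      have : ‖z‖ ^ (2*s - N) = (‖z‖⁻¹) ^ ((N:ℝ) - 2*s) := by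
        rw [Real.inv_rpow b6.le, ← Real.rpow_neg b6.le]; congr 1; ring
      rw [this]
      calc _ ≤ (2:ℝ) ^ ((N:ℝ) - 2*s) := by
            apply Real.rpow_le_rpow (by linarith) b7; linarith [hs.2]
        _ ≤ _ := by
            apply Real.rpow_le_rpow_of_exponent_le (by norm_num); linarith [hs.1]
    unfold Ftil
    rw [norm_div, norm_mul, Real.norm_of_nonneg (by positivity : 0 ≤ ‖z‖ ^ (2*s - N)), Real.norm_eq_abs,
      Real.norm_of_nonneg (by positivity : 0 ≤ dist e z ^ ((N:ℝ) + 2*s))]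
    gcongr
    · exact b9.trans (by gcongr)
    · linarith [hs.1]
  have h2 := norm_setIntegral_le_of_norm_le_const hfin hC
  rw [Real.norm_eq_abs] at h2
  refine h2.trans ?_
  have h3 : volume.real (JS N e ε \ {z | ε ≤ dist e z}) ≤ volume.real (ball (0:EN N) 1) * N * ε ^ (N+1) :=
    (measureReal_mono hsub ((measure_mono sdiff_subset).trans_lt measure_ball_lt_top).ne).trans
      (mismatch_volume N hN e h0 h1)
  calc _ ≤ 2 ^ (N:ℝ) * (K * (2 * ε)) / (ε / 2) ^ ((N:ℝ) + 2*s) * (volume.real (ball (0:EN N) 1) * N * ε ^ (N+1)) := by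
        gcongr
    _ = _ := by
        rw [Real.div_rpow h0.le (by norm_num)]
        have h5 : ε ^ (2 - 2*s) * ε ^ ((N:ℝ) + 2*s) = ε ^ (N+1) * ε := by
          rw [← Real.rpow_add h0, ← pow_succ, ← Real.rpow_natCast]; congr 1; push_cast; ring
        have : 0 < ε ^ ((N:ℝ) + 2*s) := by positivity
        generalize ε ^ (2 - 2*s) = X at *
        generalize ε ^ ((N:ℝ) + 2*s) = Y at *
        generalize (2:ℝ) ^ ((N:ℝ) + 2*s) = Z at *
        rw [div_div_eq_mul_div, div_mul_eq_mul_div, div_eq_iff this.ne']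
        linear_combination (-1 : ℝ) * (2 ^ (N:ℝ) * (K * 2) * Z * volume.real (ball (0:EN N) 1) * N) * h5

lemma fold_tendsto (N : ℕ) (hN : 2 ≤ N) (s : ℝ) (hs : s ∈ Ioo (0:ℝ) 1) (f : ℝ → ℝ) {e : EN N}
    (he : ‖e‖ = 1) {K : ℝ} (hK0 : 0 ≤ K) (hK : ∀ r ∈ Icc (1/20:ℝ) 20, |f 1 - f r| ≤ K * |1 - r|)
    (hF : ∀ ε : ℝ, 0 < ε → IntegrableOn (Fker N s f e) {z | ε ≤ dist e z})
    (hG : IntegrableOn (fun z => Fker N s f e z + Ftil N s f e z) (ball 0 1)) :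
    Tendsto (fun ε : ℝ => ∫ z in {z | ε ≤ dist e z}, Fker N s f e z) (𝓝[>] 0)
      (𝓝 (∫ z in ball (0:EN N) 1, (Fker N s f e z + Ftil N s f e z))) := by
  have := EN_nontrivial N hN
  have hsph : volume (sphere (0:EN N) 1) = 0 := Measure.addHaar_sphere _ _ _
  have hout : MeasurableSet {z : EN N | 1 < ‖z‖} := measurableSet_lt measurable_const measurable_norm
  have key : ∀ ε : ℝ, 0 < ε → ∫ z in {z | ε ≤ dist e z}, Fker N s f e z =
      (∫ z in ball (0:EN N) 1, {z | ε ≤ dist e z}.indicator (fun z => Fker N s f e z + Ftil N s f e z) z) +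
        ∫ z in JS N e ε \ {z | ε ≤ dist e z}, Ftil N s f e z := by
    intro ε hε
    have hA := Aset_meas N e ε
    have i1 : IntegrableOn (Fker N s f e) ({z | ε ≤ dist e z} ∩ ball 0 1) :=
      (hF ε hε).mono_set inter_subset_left
    have i2 : IntegrableOn (Fker N s f e) ({z | ε ≤ dist e z} ∩ {z | 1 < ‖z‖}) :=
      (hF ε hε).mono_set inter_subset_left
    have i3 := (fold_integrable N s f he ε).1 i2
    have e1 : ({z | ε ≤ dist e z} : Set (EN N)) =ᵐ[volume]
        (({z | ε ≤ dist e z} ∩ ball 0 1) ∪ ({z | ε ≤ dist e z} ∩ {z | 1 < ‖z‖}) : Set (EN N)) := by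
      have : ∀ᵐ z : EN N, z ∉ sphere (0:EN N) 1 := measure_eq_zero_iff_ae_notMem.1 hsph
      filter_upwards [this] with z hz
      apply propext
      change z ∈ {z | ε ≤ dist e z} ↔ z ∈ ({z | ε ≤ dist e z} ∩ ball 0 1) ∪ ({z | ε ≤ dist e z} ∩ {z | 1 < ‖z‖})
      rw [← inter_union_distrib_left]
      simp only [mem_inter_iff, mem_union, mem_ball_zero_iff, mem_ofPred_eq]
      simp only [mem_sphere_zero_iff_norm] at hz
      have := lt_or_gt_of_ne hz
      tauto
    have e2 : (JS N e ε ∩ {z | ε ≤ dist e z} : Set (EN N)) =ᵐ[volume]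
        ({z | ε ≤ dist e z} ∩ ball 0 1 : Set (EN N)) := by
      filter_upwards [ae_ne_zero N hN] with z hz
      apply propext
      change z ∈ JS N e ε ∩ {z | ε ≤ dist e z} ↔ z ∈ {z | ε ≤ dist e z} ∩ ball 0 1
      simp only [mem_inter_iff, mem_ball_zero_iff, mem_ofPred_eq, JS]
      constructor
      · tauto
      · rintro ⟨a, b⟩
        refine ⟨⟨b, hz, le_trans ?_ a⟩, a⟩
        nlinarith
    have i4 : IntegrableOn (Ftil N s f e) ({z | ε ≤ dist e z} ∩ ball 0 1) :=
      (i3.mono_set inter_subset_left).congr_set_ae e2.symm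
    have hdisj : Disjoint ({z | ε ≤ dist e z} ∩ ball (0:EN N) 1) ({z | ε ≤ dist e z} ∩ {z | 1 < ‖z‖}) := by
      rw [Set.disjoint_left]
      rintro z ⟨_, h1⟩ ⟨_, h2⟩
      rw [mem_ball_zero_iff] at h1
      exact lt_asymm h1 h2
    rw [setIntegral_congr_set e1, setIntegral_union hdisj (hA.inter hout) i1 i2,
      fold_integral N s f he, ← integral_inter_add_sdiff hA i3, setIntegral_congr_set e2,
      ← add_assoc, ← integral_add i1 i4, setIntegral_indicator hA, inter_comm]
  have l1 : Tendsto (fun ε : ℝ => ∫ z in ball (0:EN N) 1,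
      {z | ε ≤ dist e z}.indicator (fun z => Fker N s f e z + Ftil N s f e z) z) (𝓝[>] 0)
      (𝓝 (∫ z in ball (0:EN N) 1, (Fker N s f e z + Ftil N s f e z))) := by
    apply tendsto_integral_filter_of_dominated_convergence
      (fun z => ‖Fker N s f e z + Ftil N s f e z‖)
    · exact Eventually.of_forall fun ε => hG.aestronglyMeasurable.indicator (Aset_meas N e ε)
    · exact Eventually.of_forall fun ε => Eventually.of_forall fun z => norm_indicator_le_norm_self _ _
    · exact hG.norm
    · have : ∀ᵐ z : EN N, z ≠ e := Measure.ae_ne volume e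
      filter_upwards [ae_restrict_of_ae this] with z hz
      apply tendsto_const_nhds.congr'
      have hd : 0 < dist e z := dist_pos.2 hz.symm
      filter_upwards [Ioo_mem_nhdsGT hd] with ε hε
      rw [indicator_of_mem]
      exact hε.2.le
  have l2 : Tendsto (fun ε : ℝ => ∫ z in JS N e ε \ {z | ε ≤ dist e z}, Ftil N s f e z) (𝓝[>] 0) (𝓝 0) := by
    apply squeeze_zero_norm' (a := fun ε : ℝ => (2 ^ (N:ℝ) * (K * 2) * 2 ^ ((N:ℝ) + 2*s) * volume.real (ball (0:EN N) 1) * N) * ε ^ (2 - 2*s))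
    · filter_upwards [Ioo_mem_nhdsGT (by norm_num : (0:ℝ) < 1/2)] with ε hε
      exact mismatch_bound N hN s hs f he hK0 hK hε.1 hε.2.le
    · have h2 : 0 < 2 - 2*s := by linarith [hs.2]
      have : Tendsto (fun ε : ℝ => ε ^ (2 - 2*s)) (𝓝 0) (𝓝 (0 ^ (2 - 2*s))) :=
        (Real.continuousAt_rpow_const _ _ (Or.inr h2.le)).tendsto
      rw [Real.zero_rpow h2.ne'] at this
      simpa using (this.mono_left nhdsWithin_le_nhds).const_mul _
  have := l1.add l2
  rw [add_zero] at this
  refine this.congr' ?_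
  filter_upwards [self_mem_nhdsWithin] with ε hε
  exact (key ε hε).symm


lemma Fker_integrable (N : ℕ) (hN : 2 ≤ N) (s : ℝ) (hs : s ∈ Ioo (0:ℝ) 1) {f : ℝ → ℝ}
    (hf : Measurable f) (h : MemL1w N s (fun x => f ‖x‖)) {e : EN N} (he : ‖e‖ = 1)
    {ε : ℝ} (hε : 0 < ε) : IntegrableOn (Fker N s f e) {z | ε ≤ dist e z} := by
  have hN' : (2:ℝ) ≤ N := by exact_mod_cast hN
  have hb : 0 < (N:ℝ) + 2*s := by linarith [hs.1]
  have h0 := rpow_memL1w N hN s hs (τ := 0) ⟨by linarith, by linarith [hs.1]⟩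
  have h1 : Integrable (fun x : EN N => (2 * (ε⁻¹ + 1) ^ ((N:ℝ) + 2*s)) *
    (|f 1| * (‖x‖ ^ (0:ℝ) / (1 + ‖x‖ ^ ((N:ℝ) + 2*s))) +
      |f ‖x‖ / (1 + ‖x‖ ^ ((N:ℝ) + 2*s))|)) :=
    ((h0.const_mul |f 1|).add h.abs).const_mul _
  refine Integrable.mono' h1.integrableOn ?_ ?_
  · apply Measurable.aestronglyMeasurable
    unfold Fker
    fun_prop
  · filter_upwards [ae_restrict_mem (Aset_meas N e ε)] with z hz
    replace hz : ε ≤ dist e z := hz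
    have hd : 0 < dist e z := by linarith
    have t : ‖z‖ ≤ 1 + dist e z := by
      rw [← he, dist_eq_norm]
      calc ‖z‖ = ‖e - (e - z)‖ := by congr 1; abel
        _ ≤ _ := norm_sub_le _ _
    have t1 : 1 ≤ ε⁻¹ * dist e z := by rw [← div_eq_inv_mul, le_div_iff₀ hε]; linarith
    have t2 : ‖z‖ ≤ (ε⁻¹ + 1) * dist e z := by linarith
    have t3 : 1 ≤ (ε⁻¹ + 1) * dist e z := by linarith
    have t4 : 1 + ‖z‖ ^ ((N:ℝ) + 2*s) ≤ 2 * (ε⁻¹ + 1) ^ ((N:ℝ) + 2*s) * dist e z ^ ((N:ℝ) + 2*s) := by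
      have a1 := Real.rpow_le_rpow (norm_nonneg z) t2 hb.le
      have a2 := Real.one_le_rpow t3 hb.le
      rw [Real.mul_rpow (by positivity) hd.le] at a1 a2
      linarith
    unfold Fker
    have hp : 0 < 1 + ‖z‖ ^ ((N:ℝ) + 2*s) := by positivity
    have hdp : 0 < dist e z ^ ((N:ℝ) + 2*s) := by positivity
    rw [norm_div, Real.norm_eq_abs, Real.norm_of_nonneg hdp.le, Real.rpow_zero, abs_div, abs_of_pos hp,
      mul_one_div, ← add_div, ← mul_div_assoc, div_le_div_iff₀ hdp hp]
    have : |f 1 - f ‖z‖| ≤ |f 1| + |f ‖z‖| := abs_sub _ _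
    calc _ ≤ (|f 1| + |f ‖z‖|) * (2 * (ε⁻¹ + 1) ^ ((N:ℝ) + 2*s) * dist e z ^ ((N:ℝ) + 2*s)) := by
          gcongr
      _ = _ := by ring

lemma fpq_one (τ p q : ℝ) : fpq τ p q 1 = p := by simp [fpq]

lemma fpq_lip (τ p q : ℝ) : ∃ K : ℝ, 0 ≤ K ∧ ∀ r ∈ Icc (1/20:ℝ) 20,
    |fpq τ p q 1 - fpq τ p q r| ≤ K * |1 - r| := by
  obtain ⟨K, hK, h⟩ := lip_rpow_one τ
  refine ⟨|p| * K + |q| * (1 + K * 20) * 20, by positivity, fun r hr => ?_⟩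
  have h0 : 0 < r := by linarith [hr.1]
  have h1 := h r hr
  have h2 := abs_log_le_near hr
  have h3 : |1 - r| ≤ 20 := by rw [abs_le]; constructor <;> linarith [hr.1, hr.2]
  have h4 : r ^ τ ≤ 1 + K * 20 := by
    have := (abs_le.1 h1).1
    nlinarith [abs_nonneg (1-r)]
  rw [fpq_one]
  have h5 : p - fpq τ p q r = p * (1 - r ^ τ) - q * (r ^ τ * Real.log r) := by unfold fpq; ring
  rw [h5]
  calc _ ≤ |p| * |1 - r^τ| + |q| * (r ^ τ * |Real.log r|) := by
        refine (abs_sub _ _).trans ?_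
        rw [abs_mul, abs_mul, abs_mul, abs_of_pos (by positivity : 0 < r ^ τ)]
    _ ≤ |p| * (K * |1 - r|) + |q| * ((1 + K * 20) * (20 * |1-r|)) := by gcongr
    _ = _ := by ring

/-- folded numerator -/
def Gnum (N : ℕ) (s τ p q r : ℝ) : ℝ :=
  p * ((1 - r ^ τ) * (1 - r ^ (2*s - N - τ))) + q * (-Real.log r * (r ^ τ - r ^ (2*s - N - τ)))

lemma sum_eq_Gnum (N : ℕ) (s τ p q : ℝ) (e : EN N) {z : EN N} (hz : z ≠ 0) :
    Fker N s (fpq τ p q) e z + Ftil N s (fpq τ p q) e z =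
      Gnum N s τ p q ‖z‖ / dist e z ^ ((N:ℝ) + 2*s) := by
  have hz' : 0 < ‖z‖ := norm_pos_iff.2 hz
  unfold Fker Ftil Gnum
  rw [← add_div, fpq_one]
  congr 1
  unfold fpq
  rw [Real.log_inv, Real.inv_rpow hz'.le, Real.rpow_sub hz' _ τ]
  have : 0 < ‖z‖ ^ τ := by positivity
  field_simp
  ring

lemma Gnum_near (N : ℕ) (s τ p q : ℝ) : ∃ K : ℝ, 0 ≤ K ∧ ∀ r ∈ Icc (1/20:ℝ) 20,
    |Gnum N s τ p q r| ≤ K * |1 - r| ^ 2 := by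
  obtain ⟨K, hK, h⟩ := lip_rpow_one τ
  obtain ⟨K', hK', h'⟩ := lip_rpow_one (2*s - N - τ)
  refine ⟨|p| * (K * K') + |q| * (20 * (K' + K)), by positivity, fun r hr => ?_⟩
  have h1 := h r hr
  have h1' := h' r hr
  have h2 := abs_log_le_near hr
  have h3 : |r ^ τ - r ^ (2*s - N - τ)| ≤ (K' + K) * |1 - r| := by
    have : r ^ τ - r ^ (2*s - N - τ) = (1 - r ^ (2*s - N - τ)) - (1 - r ^ τ) := by ring
    rw [this]
    refine (abs_sub _ _).trans ?_
    linarith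
  unfold Gnum
  calc _ ≤ |p| * (|1 - r^τ| * |1 - r ^ (2*s - N - τ)|) + |q| * (|Real.log r| * |r ^ τ - r ^ (2*s - N - τ)|) := by
        refine (abs_add_le _ _).trans ?_
        simp only [abs_mul, abs_neg, le_refl]
    _ ≤ |p| * ((K * |1 - r|) * (K' * |1 - r|)) + |q| * ((20 * |1 - r|) * ((K' + K) * |1 - r|)) := by gcongr
    _ = _ := by ring

lemma dist_rpow_integrableOn_ball (N : ℕ) (hN : 2 ≤ N) {τ : ℝ} (hτ : -(N:ℝ) < τ) (e : EN N) (R : ℝ) :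
    IntegrableOn (fun x : EN N => dist e x ^ τ) (ball e R) := by
  have h := rpow_integrableOn_ball N hN hτ R
  have h2 := (measurePreserving_sub_right (volume : Measure (EN N)) e).integrableOn_comp_preimage
    (measurableEmbedding_subRight e) |>.2 h
  have h3 : (fun x => x - e) ⁻¹' ball (0:EN N) R = ball e R := by
    ext x; simp [mem_ball, dist_eq_norm]
  rw [h3] at h2
  refine h2.congr_fun (fun x _ => ?_) measurableSet_ball
  simp [dist_eq_norm, norm_sub_rev]

lemma fpq_fold_integrable (N : ℕ) (hN : 2 ≤ N) (s : ℝ) (hs : s ∈ Ioo (0:ℝ) 1) {τ : ℝ}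
    (hτ : τ ∈ Ioo (-(N:ℝ)) (2*s)) (p q : ℝ) {e : EN N} (he : ‖e‖ = 1) :
    IntegrableOn (fun z => Gnum N s τ p q ‖z‖ / dist e z ^ ((N:ℝ) + 2*s)) (ball 0 1) := by
  have hA := Fker_integrable N hN s hs (fpq_measurable τ p q) (fpq_memL1w N hN s hs hτ p q) he
    (by norm_num : (0:ℝ) < 1/2)
  have i3 := (fold_integrable N s (fpq τ p q) he (1/2)).1 (hA.mono_set inter_subset_left)
  have c1 : IntegrableOn (fun z => Gnum N s τ p q ‖z‖ / dist e z ^ ((N:ℝ) + 2*s))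
      ({z | 1/2 ≤ dist e z} ∩ JS N e (1/2)) := by
    have := (hA.mono_set (inter_subset_left (t := JS N e (1/2)))).add (i3.mono_set (inter_subset_right (s := {z | 1/2 ≤ dist e z})))
    refine IntegrableOn.congr_fun this (fun z hz => ?_) ((Aset_meas N e _).inter (JS_meas N e _))
    exact sum_eq_Gnum N s τ p q e hz.2.2.1
  have c2 : IntegrableOn (fun z => Gnum N s τ p q ‖z‖ / dist e z ^ ((N:ℝ) + 2*s)) (ball e (1/2)) := by
    obtain ⟨K, hK, h⟩ := Gnum_near N s τ p q
    have h1 := (dist_rpow_integrableOn_ball N hN (τ := 2 - ((N:ℝ) + 2*s)) (by linarith [hs.2]) e (1/2)).const_mul K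
    refine Integrable.mono' h1 ?_ ?_
    · apply Measurable.aestronglyMeasurable
      unfold Gnum
      fun_prop
    · have := EN_nontrivial N hN
      have hne : ∀ᵐ z : EN N, z ≠ e := Measure.ae_ne volume e
      filter_upwards [ae_restrict_mem measurableSet_ball, ae_restrict_of_ae hne] with z hz hze
      have hd : 0 < dist e z := dist_pos.2 hze.symm
      have hd2 : dist e z < 1/2 := by rw [dist_comm]; exact hz
      have t0 : |1 - ‖z‖| ≤ dist e z := by
        rw [← he, dist_eq_norm]; exact abs_norm_sub_norm_le e z
      have t1 := abs_le.1 t0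
      have t2 := h ‖z‖ ⟨by linarith [t1.2], by linarith [t1.1]⟩
      rw [norm_div, Real.norm_eq_abs, Real.norm_of_nonneg (by positivity : 0 ≤ dist e z ^ ((N:ℝ) + 2*s)),
        div_le_iff₀ (by positivity), mul_assoc, ← Real.rpow_add hd]
      simp only [sub_add_cancel]
      rw [show (2:ℝ) = ((2:ℕ):ℝ) by norm_num, Real.rpow_natCast]
      refine t2.trans ?_
      gcongr
  refine (c1.union c2).mono_set_ae ?_
  filter_upwards [ae_ne_zero N hN] with z hz hzb
  replace hzb : ‖z‖ < 1 := mem_ball_zero_iff.1 hzb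
  by_cases h : 1/2 ≤ dist e z
  · left
    exact ⟨h, hzb, hz, by nlinarith [norm_nonneg z]⟩
  · right
    rw [mem_ball, dist_comm]; exact not_le.1 h

/-- The folded integral. -/
def Ifold (N : ℕ) (s τ : ℝ) : ℝ :=
  ∫ z in ball (0:EN N) 1, Gnum N s τ 1 0 ‖z‖ / dist (e1 N) z ^ ((N:ℝ) + 2*s)

def Jfold (N : ℕ) (s τ : ℝ) : ℝ :=
  ∫ z in ball (0:EN N) 1, Gnum N s τ 0 1 ‖z‖ / dist (e1 N) z ^ ((N:ℝ) + 2*s)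

lemma norm_e1 (N : ℕ) (hN : 2 ≤ N) : ‖e1 N‖ = 1 := by
  have : e1 N = EuclideanSpace.single (⟨0, by omega⟩ : Fin N) (1:ℝ) := by
    ext i
    simp [e1, EuclideanSpace.single, Pi.single_apply, Fin.ext_iff]
  rw [this]; simp

lemma pv_e1 (N : ℕ) (hN : 2 ≤ N) (s : ℝ) (hs : s ∈ Ioo (0:ℝ) 1) {τ : ℝ}
    (hτ : τ ∈ Ioo (-(N:ℝ)) (2*s)) (p q : ℝ) :
    Tendsto (fun ε : ℝ => ∫ z in {z | ε ≤ dist (e1 N) z}, Fker N s (fpq τ p q) (e1 N) z) (𝓝[>] 0)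
      (𝓝 (p * Ifold N s τ + q * Jfold N s τ)) := by
  have he := norm_e1 N hN
  obtain ⟨K, hK0, hK⟩ := fpq_lip τ p q
  have hae : ∀ᵐ z : EN N ∂(volume.restrict (ball 0 1)),
      Fker N s (fpq τ p q) (e1 N) z + Ftil N s (fpq τ p q) (e1 N) z =
      Gnum N s τ p q ‖z‖ / dist (e1 N) z ^ ((N:ℝ) + 2*s) := by
    filter_upwards [ae_restrict_of_ae (ae_ne_zero N hN)] with z hz
    exact sum_eq_Gnum N s τ p q (e1 N) hz
  have := fold_tendsto N hN s hs (fpq τ p q) he hK0 hK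
    (fun ε hε => Fker_integrable N hN s hs (fpq_measurable τ p q) (fpq_memL1w N hN s hs hτ p q) he hε)
    ((fpq_fold_integrable N hN s hs hτ p q he).congr (hae.mono fun z h => h.symm))
  convert this using 2
  rw [integral_congr_ae hae, Ifold, Jfold, ← integral_const_mul, ← integral_const_mul,
    ← integral_add ((fpq_fold_integrable N hN s hs hτ 1 0 he).const_mul p)
      ((fpq_fold_integrable N hN s hs hτ 0 1 he).const_mul q)]
  congr 1
  ext z
  unfold Gnum
  ring


lemma fpq_scale (τ p q : ℝ) {ρ r : ℝ} (hρ : 0 < ρ) (hr : 0 < r) :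
    fpq τ p q ρ - fpq τ p q (ρ * r) =
      ρ ^ τ * (fpq τ (p + q * Real.log ρ) q 1 - fpq τ (p + q * Real.log ρ) q r) := by
  rw [fpq_one]
  unfold fpq
  rw [Real.mul_rpow hρ.le hr.le, Real.log_mul hρ.ne' hr.ne']
  ring

lemma pv_scale (N : ℕ) (hN : 2 ≤ N) (s : ℝ) (τ p q : ℝ) {x : EN N} (hx : x ≠ 0) (ε : ℝ) :
    ∫ z in {z | ε ≤ dist x z}, (fpq τ p q ‖x‖ - fpq τ p q ‖z‖) / dist x z ^ ((N:ℝ) + 2*s) =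
      ‖x‖ ^ (τ - 2*s) *
      ∫ z in {z | ε / ‖x‖ ≤ dist (e1 N) z}, Fker N s (fpq τ (p + q * Real.log ‖x‖) q) (e1 N) z := by
  have hρ : 0 < ‖x‖ := norm_pos_iff.2 hx
  set ρ := ‖x‖ with hρdef
  have he := norm_e1 N hN
  have hnorm : ‖e1 N‖ = ‖ρ⁻¹ • x‖ := by
    rw [norm_smul, Real.norm_of_nonneg (by positivity), he]; field_simp; rfl
  set R : EN N ≃ₗᵢ[ℝ] EN N := (ℝ ∙ (e1 N - ρ⁻¹ • x))ᗮ.reflection with hR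
  have hRe : R (e1 N) = ρ⁻¹ • x := Submodule.reflection_sub hnorm
  have hxe : x = ρ • R (e1 N) := by rw [hRe, smul_smul, mul_inv_cancel₀ hρ.ne', one_smul]
  have hdist : ∀ w, dist x (ρ • R w) = ρ * dist (e1 N) w := by
    intro w
    rw [hxe, dist_smul₀, R.dist_map, Real.norm_of_nonneg hρ.le]
  rw [← integral_indicator (Aset_meas N x ε), ← integral_indicator (Aset_meas N (e1 N) (ε/ρ))]
  set g : EN N → ℝ := {z | ε ≤ dist x z}.indicator
    fun z => (fpq τ p q ρ - fpq τ p q ‖z‖) / dist x z ^ ((N:ℝ) + 2*s) with hg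
  have h1 : ∫ z, g z = ρ ^ N * ∫ w, g (ρ • R w) := by
    have a := Measure.integral_comp_smul (volume : Measure (EN N)) g ρ
    have b := R.measurePreserving.integral_comp R.toHomeomorph.measurableEmbedding (fun w => g (ρ • w))
    rw [b, a]
    simp only [finrank_euclideanSpace, Fintype.card_fin, smul_eq_mul]
    rw [abs_of_pos (by positivity)]
    field_simp
  rw [h1, ← integral_const_mul, ← integral_const_mul]
  apply integral_congr_ae
  filter_upwards [ae_ne_zero N hN] with w hw
  have hw' : 0 < ‖w‖ := norm_pos_iff.2 hw
  have hn : ‖ρ • R w‖ = ρ * ‖w‖ := by rw [norm_smul, R.norm_map, Real.norm_of_nonneg hρ.le]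
  by_cases hc : ε / ρ ≤ dist (e1 N) w
  · have hc' : ε ≤ dist x (ρ • R w) := by
      rw [hdist]; rw [div_le_iff₀ hρ] at hc; linarith
    rw [hg, indicator_of_mem (by exact hc'), indicator_of_mem (by exact hc), hdist, hn,
      fpq_scale τ p q hρ hw', Real.mul_rpow hρ.le dist_nonneg, Fker]
    have : ρ ^ (τ - 2*s) = ρ ^ N * ρ ^ τ / ρ ^ ((N:ℝ) + 2*s) := by
      rw [← Real.rpow_natCast, ← Real.rpow_add hρ, ← Real.rpow_sub hρ]; congr 1; ring
    rw [this, mul_div_mul_comm]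
    ring
  · have hc' : ¬ ε ≤ dist x (ρ • R w) := by
      rw [hdist]; rw [div_le_iff₀ hρ] at hc; linarith
    rw [hg, indicator_of_notMem (by exact hc'), indicator_of_notMem (by exact hc)]
    simp

lemma fpq_hasFracLap (N : ℕ) (hN : 2 ≤ N) (s : ℝ) (hs : s ∈ Ioo (0:ℝ) 1) {τ : ℝ}
    (hτ : τ ∈ Ioo (-(N:ℝ)) (2*s)) (p q : ℝ) {x : EN N} (hx : x ≠ 0) :
    HasFracLap N s (fun z => fpq τ p q ‖z‖) x
      (CNs N s * (‖x‖ ^ (τ - 2*s) * ((p + q * Real.log ‖x‖) * Ifold N s τ + q * Jfold N s τ))) := by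
  have hρ : 0 < ‖x‖ := norm_pos_iff.2 hx
  unfold HasFracLap
  simp_rw [pv_scale N hN s τ p q hx]
  refine Tendsto.const_mul _ (Tendsto.const_mul _ ?_)
  refine (pv_e1 N hN s hs hτ (p + q * Real.log ‖x‖) q).comp ?_
  refine tendsto_nhdsWithin_iff.2 ⟨?_, ?_⟩
  · have : Tendsto (fun ε : ℝ => ε / ‖x‖) (𝓝 0) (𝓝 (0 / ‖x‖)) := tendsto_id.div_const _
    rw [zero_div] at this
    exact this.mono_left nhdsWithin_le_nhds
  · filter_upwards [self_mem_nhdsWithin] with ε hε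
    exact div_pos hε hρ

lemma Phi_eq_mu0 (N : ℕ) (s τ : ℝ) : Phi N s (mu0 N s) τ = fun z => fpq τ 0 (-1) ‖z‖ := by
  ext z; simp [Phi, fpq]

lemma Phi_eq_ne (N : ℕ) (s τ : ℝ) {μ : ℝ} (h : μ ≠ mu0 N s) : Phi N s μ τ = fun z => fpq τ 1 0 ‖z‖ := by
  ext z; simp [Phi, fpq, h]

lemma pow_eq_fpq (N : ℕ) (τ : ℝ) : (fun z : EN N => ‖z‖ ^ τ) = fun z => fpq τ 1 0 ‖z‖ := by
  ext z; simp [fpq]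

lemma fpq_contDiffOn (N : ℕ) (τ p q : ℝ) :
    ContDiffOn ℝ (⊤ : ℕ∞) (fun z : EN N => fpq τ p q ‖z‖) {(0:EN N)}ᶜ := by
  intro z hz
  have hz0 : z ≠ 0 := hz
  have h1 : ContDiffAt ℝ (⊤ : ℕ∞) (fun z : EN N => ‖z‖) z := contDiffAt_norm ℝ hz0
  have hn : ‖z‖ ≠ 0 := norm_ne_zero_iff.2 hz0
  apply ContDiffAt.contDiffWithinAt
  unfold fpq
  exact (h1.rpow_const_of_ne hn).mul (contDiffAt_const.add (contDiffAt_const.mul (h1.log hn)))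


lemma dist_e1_pos (N : ℕ) (hN : 2 ≤ N) {z : EN N} (hz : ‖z‖ < 1) : 0 < dist (e1 N) z := by
  rw [dist_pos]
  rintro rfl
  rw [norm_e1 N hN] at hz
  exact lt_irrefl _ hz

lemma ball_pos_integral (N : ℕ) (hN : 2 ≤ N) {F : EN N → ℝ}
    (hF : IntegrableOn F (ball 0 1)) (hpos : ∀ z : EN N, z ≠ 0 → ‖z‖ < 1 → 0 < F z) :
    0 < ∫ z in ball (0:EN N) 1, F z := by
  have h0 : ∀ᵐ z ∂(volume.restrict (ball (0:EN N) 1)), 0 ≤ F z := by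
    filter_upwards [ae_restrict_mem measurableSet_ball, ae_restrict_of_ae (ae_ne_zero N hN)] with z hz hz0
    exact (hpos z hz0 (by simpa using hz)).le
  rw [setIntegral_pos_iff_support_of_nonneg_ae h0 hF]
  have : volume (ball (0:EN N) 1) ≤ volume (Function.support F ∩ ball 0 1) := by
    apply measure_mono_ae
    filter_upwards [ae_ne_zero N hN] with z hz0 hz
    have hz' : z ∈ ball (0:EN N) 1 := hz
    exact ⟨(hpos z hz0 (by simpa using hz')).ne', hz⟩
  exact lt_of_lt_of_le (measure_ball_pos _ _ one_pos) this

lemma Gnum_I (N : ℕ) (s τ : ℝ) {r : ℝ} :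
    Gnum N s τ 1 0 r = (1 - r^τ) * (1 - r^(2*s-N-τ)) := by simp [Gnum]

lemma Gnum_I' (N : ℕ) (s τ : ℝ) {r : ℝ} (hr : 0 < r) :
    Gnum N s τ 1 0 r = 1 + r^(2*s-N) - r^τ - r^(2*s-N-τ) := by
  rw [Gnum_I]
  have : r^(2*s-N) = r^τ * r^(2*s-N-τ) := by rw [← Real.rpow_add hr]; congr 1; ring
  rw [this]; ring

lemma Ifold_symm (N : ℕ) (s τ : ℝ) : Ifold N s (2*s-N-τ) = Ifold N s τ := by
  unfold Ifold
  congr 1; ext z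
  rw [Gnum_I, Gnum_I]
  congr 1
  rw [mul_comm]; congr 3; ring

lemma Ifold_zero (N : ℕ) (s : ℝ) : Ifold N s 0 = 0 := by
  unfold Ifold
  simp [Gnum_I]

lemma Jfold_mid (N : ℕ) (s : ℝ) : Jfold N s ((2*s-N)/2) = 0 := by
  unfold Jfold
  have : (2*s-N) - (2*s-N)/2 = (2*s-(N:ℝ))/2 := by ring
  simp [Gnum, this]

lemma mid_mem (N : ℕ) (hN : 2 ≤ N) (s : ℝ) (hs : s ∈ Ioo (0:ℝ) 1) :
    -(N:ℝ) < (2*s-N)/2 ∧ (2*s-N)/2 < 0 := by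
  have : (2:ℝ) ≤ N := by exact_mod_cast hN
  obtain ⟨h1, h2⟩ := hs
  constructor <;> linarith

lemma Jfold_pos (N : ℕ) (hN : 2 ≤ N) (s : ℝ) (hs : s ∈ Ioo (0:ℝ) 1) {τ : ℝ}
    (h1 : -(N:ℝ) < τ) (h2 : τ < (2*s-N)/2) : 0 < Jfold N s τ := by
  have hm := mid_mem N hN s hs
  unfold Jfold
  apply ball_pos_integral N hN (fpq_fold_integrable N hN s hs ⟨h1, by linarith [hs.1]⟩ 0 1 (norm_e1 N hN))
  intro z hz0 hz
  have hr : 0 < ‖z‖ := norm_pos_iff.2 hz0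
  apply div_pos _ (Real.rpow_pos_of_pos (dist_e1_pos N hN hz) _)
  unfold Gnum
  have a := Real.log_neg hr hz
  have b := Real.rpow_lt_rpow_of_exponent_gt hr hz (show τ < 2*s-N-τ by linarith)
  nlinarith [mul_pos (neg_pos.2 a) (sub_pos.2 b)]

lemma Gnum_anti (N : ℕ) (s : ℝ) {r τ τ' : ℝ} (hr : 0 < r) (hr1 : r < 1)
    (h1 : (2*s-N)/2 ≤ τ) (h2 : τ < τ') : Gnum N s τ' 1 0 r < Gnum N s τ 1 0 r := by
  rw [Gnum_I' N s τ hr, Gnum_I' N s τ' hr]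
  have e1 : r^(2*s-N-τ) = r^(2*s-N) / r^τ := Real.rpow_sub hr _ _
  have e2 : r^(2*s-N-τ') = r^(2*s-N) / r^τ' := Real.rpow_sub hr _ _
  rw [e1, e2]
  have hx : 0 < r^τ := Real.rpow_pos_of_pos hr _
  have hx' : 0 < r^τ' := Real.rpow_pos_of_pos hr _
  have hlt := Real.rpow_lt_rpow_of_exponent_gt hr hr1 h2
  have hP : r^τ * r^τ' < r^(2*s-N) := by
    rw [← Real.rpow_add hr]
    exact Real.rpow_lt_rpow_of_exponent_gt hr hr1 (by linarith)
  have : (r^τ - r^τ') * (r^(2*s-N)/(r^τ * r^τ') - 1) > 0 := by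
    apply mul_pos (sub_pos.2 hlt)
    rw [sub_pos, lt_div_iff₀ (mul_pos hx hx')]; linarith
  have k : (r^τ - r^τ') * (r^(2*s-N)/(r^τ * r^τ') - 1)
    = r^(2*s-N)/r^τ' - r^(2*s-N)/r^τ - r^τ + r^τ' := by
    field_simp
    ring
  linarith

lemma Ifold_anti (N : ℕ) (hN : 2 ≤ N) (s : ℝ) (hs : s ∈ Ioo (0:ℝ) 1) :
    StrictAntiOn (Ifold N s) (Ico ((2*s-N)/2) (2*s)) := by
  intro τ hτ τ' hτ' hlt
  have hm := mid_mem N hN s hs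
  have i1 := fpq_fold_integrable N hN s hs (τ := τ) ⟨by linarith [hτ.1], hτ.2⟩ 1 0 (norm_e1 N hN)
  have i2 := fpq_fold_integrable N hN s hs (τ := τ') ⟨by linarith [hτ'.1], hτ'.2⟩ 1 0 (norm_e1 N hN)
  have := ball_pos_integral N hN (i1.sub i2) (by
    intro z hz0 hz
    have hr : 0 < ‖z‖ := norm_pos_iff.2 hz0
    have := div_lt_div_of_pos_right (Gnum_anti N s hr hz hτ.1 hlt)
      (Real.rpow_pos_of_pos (dist_e1_pos N hN hz) ((N:ℝ)+2*s))
    simp only [Pi.sub_apply]; linarith)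
  simp only [Pi.sub_apply] at this
  rw [integral_sub i1 i2] at this
  unfold Ifold
  linarith

lemma rpow_convex {r : ℝ} (hr : 0 < r) {a b x y : ℝ} (ha : 0 ≤ a) (hb : 0 ≤ b) (hab : a + b = 1) :
    r^(a*x+b*y) ≤ a * r^x + b * r^y := by
  have := Real.geom_mean_le_arith_mean2_weighted ha hb (Real.rpow_nonneg hr.le x) (Real.rpow_nonneg hr.le y) hab
  rwa [← Real.rpow_mul hr.le, ← Real.rpow_mul hr.le, ← Real.rpow_add hr, mul_comm x, mul_comm y] at this

lemma Ifold_cont (N : ℕ) (hN : 2 ≤ N) (s : ℝ) (hs : s ∈ Ioo (0:ℝ) 1) :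
    ContinuousOn (Ifold N s) (Ioo (-(N:ℝ)) (2*s)) := by
  apply ConcaveOn.continuousOn isOpen_Ioo
  refine ⟨convex_Ioo _ _, ?_⟩
  intro x hx y hy a b ha hb hab
  have hxy := (convex_Ioo (-(N:ℝ)) (2*s)) hx hy ha hb hab
  have i1 := fpq_fold_integrable N hN s hs hx 1 0 (norm_e1 N hN)
  have i2 := fpq_fold_integrable N hN s hs hy 1 0 (norm_e1 N hN)
  have i3 := fpq_fold_integrable N hN s hs hxy 1 0 (norm_e1 N hN)
  simp only [smul_eq_mul] at *
  unfold Ifold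
  rw [← integral_const_mul, ← integral_const_mul, ← integral_add (i1.const_mul a) (i2.const_mul b)]
  apply integral_mono_ae ((i1.const_mul a).add (i2.const_mul b)) i3
  filter_upwards [ae_restrict_mem measurableSet_ball, ae_restrict_of_ae (ae_ne_zero N hN)] with z hz hz0
  have hr : 0 < ‖z‖ := norm_pos_iff.2 hz0
  have hd := (Real.rpow_pos_of_pos (dist_e1_pos N hN (show ‖z‖ < 1 by simpa using hz)) ((N:ℝ)+2*s))
  simp only [Pi.add_apply]
  rw [← mul_div_assoc, ← mul_div_assoc, ← add_div]
  apply div_le_div_of_nonneg_right _ hd.le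
  rw [Gnum_I' N s _ hr, Gnum_I' N s _ hr, Gnum_I' N s _ hr]
  have c1 := rpow_convex hr (x := x) (y := y) ha hb hab
  have c2 := rpow_convex hr (x := 2*s-N-x) (y := 2*s-N-y) ha hb hab
  have : a*(2*s-N-x) + b*(2*s-N-y) = 2*s-N-(a*x+b*y) := by
    have : b = 1 - a := by linarith
    subst this; ring
  rw [this] at c2
  have e : b = 1 - a := by linarith
  subst e
  nlinarith

lemma CNs_pos (N : ℕ) (s : ℝ) (hs : s ∈ Ioo (0:ℝ) 1) : 0 < CNs N s := by
  unfold CNs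
  have h1 := Real.Gamma_pos_of_pos (show 0 < 1 - s by linarith [hs.2])
  have h2 := Real.Gamma_pos_of_pos (show 0 < ((N:ℝ) + 2*s)/2 by
    have := hs.1
    positivity)
  have := hs.1
  have := Real.pi_pos
  positivity

lemma ball_rpow_integral (N : ℕ) (hN : 2 ≤ N) {σ : ℝ} (hσ : -(N:ℝ) < σ) :
    ∫ z in ball (0:EN N) (1/2), ‖z‖^σ =
      N * volume.real (ball (0:EN N) 1) * ((1/2)^(N+σ) / (N+σ)) := by
  have := EN_nontrivial N hN
  rw [← integral_indicator measurableSet_ball]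
  have : (ball (0:EN N) (1/2)).indicator (fun z => ‖z‖^σ)
    = fun z => (Iio (1/2:ℝ)).indicator (fun r => r^σ) ‖z‖ := by
    ext z
    by_cases h : ‖z‖ < 1/2
    · rw [indicator_of_mem (by simpa using h), indicator_of_mem (by simpa using h)]
    · rw [indicator_of_notMem (by simpa using h), indicator_of_notMem (by simpa using h)]
  rw [this, integral_fun_norm_addHaar]
  simp only [finrank_euclideanSpace, Fintype.card_fin, nsmul_eq_mul, smul_eq_mul]
  have key : ∫ y in Ioi (0:ℝ), y^(N-1) * (Iio (1/2:ℝ)).indicator (fun r => r^σ) y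
     = (1/2)^(N+σ) / (N+σ) := by
    have e : ∀ y ∈ Ioi (0:ℝ), y^(N-1) * (Iio (1/2:ℝ)).indicator (fun r => r^σ) y
      = (Iio (1/2:ℝ)).indicator (fun y => y^((N:ℝ)-1+σ)) y := by
      intro y hy
      by_cases h : y < 1/2
      · rw [indicator_of_mem (by simpa using h), indicator_of_mem (by simpa using h),
          Real.rpow_add hy, ← Real.rpow_natCast]
        congr 2
        rw [Nat.cast_sub (by omega)]; simp
      · rw [indicator_of_notMem (by simpa using h), indicator_of_notMem (by simpa using h), mul_zero]
    rw [setIntegral_congr_fun measurableSet_Ioi e, setIntegral_indicator measurableSet_Iio,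
      Ioi_inter_Iio, ← integral_Ioc_eq_integral_Ioo, ← intervalIntegral.integral_of_le (by norm_num),
      integral_rpow (Or.inl (by linarith))]
    have : (N:ℝ) - 1 + σ + 1 = N + σ := by ring
    rw [this, Real.zero_rpow (by linarith), sub_zero]
  rw [key]; ring

lemma Ifold_unbdd (N : ℕ) (hN : 2 ≤ N) (s : ℝ) (hs : s ∈ Ioo (0:ℝ) 1) (M : ℝ) :
    ∃ τ ∈ Ioo (0:ℝ) (2*s), Ifold N s τ < M := by
  have hm := mid_mem N hN s hs
  have := EN_nontrivial N hN
  have hN' : (2:ℝ) ≤ N := by exact_mod_cast hN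
  obtain ⟨hs0, hs1⟩ := hs
  set b := (N:ℝ) + 2*s with hb
  set k : ℝ := (1 - (1/2:ℝ)^s) * (2^b)⁻¹ with hk
  have hk0 : 0 < k := by
    have : (1/2:ℝ)^s < 1 := Real.rpow_lt_one (by norm_num) (by norm_num) hs0
    have : 0 < 1 - (1/2:ℝ)^s := by linarith
    positivity
  set V := volume.real (ball (0:EN N) 1) with hV
  have hV0 : 0 < V := by
    rw [hV, measureReal_def]
    exact ENNReal.toReal_pos (measure_ball_pos _ _ one_pos).ne' measure_ball_lt_top.ne
  set V2 := volume.real (ball (0:EN N) (1/2)) with hV2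
  have bound : ∀ τ ∈ Ico s (2*s), Ifold N s τ ≤
      -(k * (N * V * ((1/2)^(2*s-τ) / (2*s-τ)) - V2)) := by
    intro τ hτ
    have hσ : -(N:ℝ) < 2*s-N-τ := by linarith [hτ.2]
    have i1 := fpq_fold_integrable N hN s ⟨hs0,hs1⟩ (τ := τ) ⟨by linarith [hτ.1], hτ.2⟩ 1 0 (norm_e1 N hN)
    have i2 : IntegrableOn (fun z : EN N => ‖z‖^(2*s-N-τ)) (ball 0 (1/2)) := rpow_integrableOn_ball N hN hσ _
    have i3 : IntegrableOn (fun z : EN N => (1:ℝ)) (ball (0:EN N) (1/2)) :=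
      integrableOn_const measure_ball_lt_top.ne
    have e : ∫ z in ball (0:EN N) (1/2), (k * (‖z‖^(2*s-N-τ) - 1)) =
      (k * (N * V * ((1/2)^(2*s-τ) / (2*s-τ)) - V2)) := by
      rw [integral_const_mul, integral_sub i2 i3, ball_rpow_integral N hN hσ]
      have : (N:ℝ) + (2*s-N-τ) = 2*s-τ := by ring
      rw [this]; simp [hV2, hV]
    rw [← e]
    have sub : ball (0:EN N) (1/2) ⊆ ball 0 1 := ball_subset_ball (by norm_num)
    unfold Ifold
    rw [← neg_neg (∫ z in ball (0:EN N) 1, _), ← integral_neg]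
    have pt : ∀ z : EN N, z ≠ 0 → ‖z‖ < 1 → 0 ≤ -(Gnum N s τ 1 0 ‖z‖ / dist (e1 N) z ^ b) := by
      intro z hz0 hz
      have hr : 0 < ‖z‖ := norm_pos_iff.2 hz0
      have hd := (Real.rpow_pos_of_pos (dist_e1_pos N hN hz) b)
      rw [← neg_div]
      apply div_nonneg _ hd.le
      rw [Gnum_I]
      have a1 : ‖z‖^τ ≤ 1 := Real.rpow_le_one hr.le hz.le (by linarith [hτ.1])
      have a2 : 1 ≤ ‖z‖^(2*s-N-τ) := Real.one_le_rpow_of_pos_of_le_one_of_nonpos hr hz.le (by linarith [hτ.1])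
      nlinarith
    have s1 : ∫ z in ball (0:EN N) (1/2), -(Gnum N s τ 1 0 ‖z‖ / dist (e1 N) z ^ b) ≤
       ∫ z in ball (0:EN N) 1, -(Gnum N s τ 1 0 ‖z‖ / dist (e1 N) z ^ b) := by
      apply setIntegral_mono_set i1.neg _ sub.eventuallyLE
      filter_upwards [ae_restrict_mem measurableSet_ball, ae_restrict_of_ae (ae_ne_zero N hN)] with z hz hz0
      exact pt z hz0 (by simpa using hz)
    have s2 : ∫ z in ball (0:EN N) (1/2), (k * (‖z‖^(2*s-N-τ) - 1)) ≤
      ∫ z in ball (0:EN N) (1/2), -(Gnum N s τ 1 0 ‖z‖ / dist (e1 N) z ^ b) := by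
      apply integral_mono_ae ((i2.sub i3).const_mul k) (i1.mono_set sub).neg
      filter_upwards [ae_restrict_mem measurableSet_ball, ae_restrict_of_ae (ae_ne_zero N hN)] with z hz hz0
      have hr : 0 < ‖z‖ := norm_pos_iff.2 hz0
      have hz : ‖z‖ < 1/2 := by simpa using hz
      have hd0 := (dist_e1_pos N hN (z := z) (by linarith))
      have hd := (Real.rpow_pos_of_pos hd0 b)
      have hd2 : dist (e1 N) z ^ b ≤ 2^b := by
        apply Real.rpow_le_rpow dist_nonneg _ (by rw [hb]; linarith)
        rw [dist_eq_norm]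
        have := norm_sub_le (e1 N) z
        rw [norm_e1 N hN] at this
        linarith
      have a1 : ‖z‖^τ ≤ (1/2)^s := by
        calc ‖z‖^τ ≤ ‖z‖^s := Real.rpow_le_rpow_of_exponent_ge hr (by linarith) hτ.1
          _ ≤ _ := Real.rpow_le_rpow hr.le hz.le hs0.le
      have a2 : 1 ≤ ‖z‖^(2*s-N-τ) := Real.one_le_rpow_of_pos_of_le_one_of_nonpos hr (by linarith) (by linarith [hτ.1])
      simp only [Pi.sub_apply, Pi.neg_apply]
      rw [← hb, Gnum_I, ← neg_div, hk]
      have a3 : (1/2:ℝ)^s < 1 := Real.rpow_lt_one (by norm_num) (by norm_num) hs0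
      have : -((1 - ‖z‖^τ) * (1 - ‖z‖^(2*s-N-τ))) / dist (e1 N) z ^ b =
        (1 - ‖z‖^τ) * (dist (e1 N) z ^ b)⁻¹ * (‖z‖^(2*s-N-τ) - 1) := by
        rw [div_eq_mul_inv]; ring
      rw [this]
      apply mul_le_mul_of_nonneg_right _ (by linarith)
      apply mul_le_mul (by linarith) (inv_anti₀ hd hd2) (by positivity) (by linarith)
    rw [← hb]
    linarith
  -- choose τ
  have hc : 0 < k * (N * V * ((1/2)^(2*s))) := by positivity
  set c := k * (N * V * ((1/2)^(2*s))) with hcdef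
  set d := |k * V2 - M| + 1 with hd
  have hd0 : 0 < d := by positivity
  set η := min s (c/d/2) with hη
  have hη0 : 0 < η := lt_min hs0 (by positivity)
  refine ⟨2*s-η, ⟨by linarith [min_le_left s (c/d/2)], by linarith⟩, ?_⟩
  have b1 := bound (2*s-η) ⟨by linarith [min_le_left s (c/d/2)], by linarith⟩
  have : 2*s-(2*s-η) = η := by ring
  rw [this] at b1
  have g1 : (1/2:ℝ)^(2*s) ≤ (1/2)^η := by
    apply Real.rpow_le_rpow_of_exponent_ge (by norm_num) (by norm_num)
    linarith [min_le_left s (c/d/2)]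
  have g2 : c / η ≤ k * (N * V * ((1/2)^η / η)) := by
    rw [hcdef]
    have : k * (N * V * ((1/2:ℝ)^η / η)) = k * (N * V * ((1/2)^η)) / η := by ring
    rw [this]
    gcongr
  have g3 : d < c / η := by
    rw [lt_div_iff₀ hη0]
    have : η ≤ c/d/2 := min_le_right _ _
    calc d * η ≤ d * (c/d/2) := by gcongr
      _ = c/2 := by field_simp
      _ < c := by linarith
  have g4 := le_abs_self (k * V2 - M)
  nlinarith


lemma U_spec (N : ℕ) (hN : 2 ≤ N) (s : ℝ) (hs : s ∈ Ioo (0:ℝ) 1) :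
    Integrable (fun z : EN N => (1 - ‖z‖^((2*s-N)/2))^2 / dist (e1 N) z ^ ((N:ℝ)+2*s)) ∧
    ∫ z : EN N, (1 - ‖z‖^((2*s-N)/2))^2 / dist (e1 N) z ^ ((N:ℝ)+2*s) = 2 * Ifold N s ((2*s-N)/2) := by
  have := EN_nontrivial N hN
  have hm := mid_mem N hN s hs
  set m := (2*s-N)/2 with hmdef
  set U := (fun z : EN N => (1 - ‖z‖^m)^2 / dist (e1 N) z ^ ((N:ℝ)+2*s)) with hU
  set f : ℝ → ℝ := fun r => -(1 - r^m)^2 with hf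
  have hFk : Fker N s f (e1 N) = U := by
    ext z; simp [Fker, hf, hU]
  have hGn : (fun z => Gnum N s m 1 0 ‖z‖ / dist (e1 N) z ^ ((N:ℝ)+2*s)) = U := by
    ext z
    rw [Gnum_I, hU]
    have : 2*s-N-m = m := by rw [hmdef]; ring
    rw [this]; simp only []; ring
  have hFt : ∀ z ∈ JS N (e1 N) 0, Ftil N s f (e1 N) z = U z := by
    intro z hz
    have hr : 0 < ‖z‖ := norm_pos_iff.2 hz.2.1
    simp only [Ftil, hU, hf]
    congr 1
    have e1 : ‖z‖^(2*s-N) = ‖z‖^m * ‖z‖^m := by rw [← Real.rpow_add hr]; congr 1; rw [hmdef]; ring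
    rw [Real.inv_rpow hr.le, e1]
    have : 0 < ‖z‖^m := Real.rpow_pos_of_pos hr _
    simp only [Real.one_rpow]
    field_simp
    ring
  have hset : ({z | 0 ≤ dist (e1 N) z} ∩ {z : EN N| 1 < ‖z‖}) = {z : EN N| 1 < ‖z‖} := by
    ext z; simp [dist_nonneg]
  have hJS : JS N (e1 N) 0 =ᵐ[volume] ball (0:EN N) 1 := by
    filter_upwards [ae_ne_zero N hN] with z hz
    apply propext
    change z ∈ JS N (e1 N) 0 ↔ z ∈ ball (0:EN N) 1
    simp [JS, hz, dist_nonneg]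
  have hUb : IntegrableOn U (ball 0 1) := by
    rw [← hGn]
    exact fpq_fold_integrable N hN s hs ⟨hm.1, by linarith [hs.1]⟩ 1 0 (norm_e1 N hN)
  have hUJ : IntegrableOn U (JS N (e1 N) 0) := hUb.congr_set_ae hJS
  have hUo : IntegrableOn U {z : EN N| 1 < ‖z‖} := by
    rw [← hset, ← hFk, fold_integrable N s f (norm_e1 N hN)]
    exact (integrableOn_congr_fun hFt (JS_meas _ _ _)).2 hUJ
  have hout : MeasurableSet {z : EN N | 1 < ‖z‖} := measurableSet_lt measurable_const measurable_norm
  have hIo : ∫ z in {z : EN N| 1 < ‖z‖}, U z = ∫ z in ball (0:EN N) 1, U z := by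
    rw [← hset, ← hFk, fold_integral N s f (norm_e1 N hN), setIntegral_congr_fun (JS_meas _ _ _) hFt,
      setIntegral_congr_set hJS, hFk]
  have hsph : volume (sphere (0:EN N) 1) = 0 := Measure.addHaar_sphere _ _ _
  have huniv : (ball (0:EN N) 1 ∪ {z : EN N | 1 < ‖z‖} : Set (EN N)) =ᵐ[volume] univ := by
    rw [← compl_compl (ball (0:EN N) 1 ∪ {z : EN N | 1 < ‖z‖})]
    have h0 : volume ((ball (0:EN N) 1 ∪ {z : EN N | 1 < ‖z‖})ᶜ) = 0 := by
      refine measure_mono_null ?_ hsph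
      intro z hz
      simp only [mem_compl_iff, mem_union, mem_ball_zero_iff, mem_ofPred_eq, not_or, not_lt] at hz
      simp; linarith [hz.1, hz.2]
    exact (compl_mem_ae_iff.2 h0) |> eventuallyEq_univ.2
  have hdisj : Disjoint (ball (0:EN N) 1) {z : EN N | 1 < ‖z‖} := by
    rw [Set.disjoint_left]
    intro z h1 h2
    simp at h1
    have h2 : 1 < ‖z‖ := h2
    linarith
  constructor
  · rw [← integrableOn_univ]
    exact (hUb.union hUo).congr_set_ae huniv.symm
  · rw [← setIntegral_univ, ← setIntegral_congr_set huniv, setIntegral_union hdisj hout hUb hUo, hIo]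
    rw [Ifold, hGn]; ring


lemma bern {β w : ℝ} (hβ : 0 < β) (hw0 : 0 < w) (hw1 : w < 1) :
    0 ≤ 1 - (1-w)^β ∧ 1 - (1-w)^β ≤ (1+β) * w := by
  constructor
  · have := Real.rpow_le_one (show 0 ≤ 1-w by linarith) (by linarith) hβ.le
    linarith
  · rcases le_total 1 β with h | h
    · have := one_add_mul_self_le_rpow_one_add (show -1 ≤ -w by linarith) h
      rw [← sub_eq_add_neg] at this
      nlinarith
    · have := Real.rpow_le_rpow_of_exponent_ge (show 0 < 1-w by linarith) (by linarith) h
      rw [Real.rpow_one] at this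
      nlinarith

lemma beta_int {s β : ℝ} (hs : s ∈ Ioo (0:ℝ) 1) (hβ : 0 < β) :
    IntegrableOn (fun w : ℝ => w^(-s) * (1-w)^(β-1)) (Ioo 0 1) ∧
    ∫ w in Ioo (0:ℝ) 1, w^(-s) * (1-w)^(β-1) =
      Real.Gamma (1-s) * Real.Gamma β / Real.Gamma (1-s+β) := by
  have h1 : 0 < 1 - s := by linarith [hs.2]
  have hc := Complex.betaIntegral_convergent (u := ((1-s:ℝ):ℂ)) (v := (β:ℂ)) (by simpa using h1) (by simpa using hβ)
  rw [intervalIntegrable_iff_integrableOn_Ioo_of_le zero_le_one] at hc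
  have e : ∀ w ∈ Ioo (0:ℝ) 1, ((w:ℂ) ^ (((1-s:ℝ):ℂ) - 1) * (1 - (w:ℂ)) ^ ((β:ℂ) - 1)).re
      = w^(-s) * (1-w)^(β-1) := by
    intro w hw
    have a1 : ((w:ℂ) ^ (((1-s:ℝ):ℂ) - 1)) = ((w^(-s) : ℝ) : ℂ) := by
      rw [Complex.ofReal_cpow hw.1.le]; congr 1; push_cast; ring
    have a2 : ((1 - (w:ℂ)) ^ ((β:ℂ) - 1)) = (((1-w)^(β-1) : ℝ) : ℂ) := by
      rw [Complex.ofReal_cpow (by linarith [hw.2])]; push_cast; rfl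
    rw [a1, a2, ← Complex.ofReal_mul, Complex.ofReal_re]
  refine ⟨(integrableOn_congr_fun e measurableSet_Ioo).1 hc.re, ?_⟩
  have hb := ProbabilityTheory.beta_eq_betaIntegralReal (1-s) β h1 hβ
  rw [ProbabilityTheory.beta] at hb
  rw [hb, Complex.betaIntegral, intervalIntegral.integral_of_le zero_le_one,
    integral_Ioc_eq_integral_Ioo, ← setIntegral_congr_fun measurableSet_Ioo e]
  exact integral_re hc

/-- the kernel function -/
def kw (β w : ℝ) : ℝ := 1 - (Iio (1:ℝ)).indicator (fun w => (1-w)^(β-1)) w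

lemma kw_spec {s β : ℝ} (hs : s ∈ Ioo (0:ℝ) 1) (hβ : 0 < β) :
    IntegrableOn (fun w : ℝ => w^(-1-s) * kw β w) (Ioi 0) ∧
    ∫ w in Ioi (0:ℝ), w^(-1-s) * kw β w =
      (β/s - 1) * (Real.Gamma (1-s) * Real.Gamma β / Real.Gamma (1-s+β)) := by
  obtain ⟨hs0, hs1⟩ := id hs
  obtain ⟨bi, bv⟩ := beta_int hs hβ
  set B := Real.Gamma (1-s) * Real.Gamma β / Real.Gamma (1-s+β) with hB
  -- first piece
  have i1 : IntegrableOn (fun w : ℝ => w^(-1-s) * (1 - (1-w)^β)) (Ioo 0 1) := by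
    have g : IntegrableOn (fun w : ℝ => (1+β) * w^(-s)) (Ioo 0 1) := by
      have := intervalIntegral.intervalIntegrable_rpow' (a := 0) (b := 1) (r := -s) (by linarith)
      rw [intervalIntegrable_iff_integrableOn_Ioo_of_le zero_le_one] at this
      exact this.const_mul _
    refine Integrable.mono' g ?_ ?_
    · apply Measurable.aestronglyMeasurable; fun_prop
    · filter_upwards [ae_restrict_mem measurableSet_Ioo] with w hw
      obtain ⟨a, b⟩ := bern hβ hw.1 hw.2
      have p := Real.rpow_pos_of_pos hw.1 (-1-s)
      rw [Real.norm_of_nonneg (by positivity)]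
      have : w^(-s) = w^(-1-s) * w := by
        nth_rw 3 [← Real.rpow_one w]
        rw [← Real.rpow_add hw.1]; congr 1; ring
      rw [this]
      nlinarith
  have v1 : ∫ w in Ioo (0:ℝ) 1, (w^(-1-s) * (1 - (1-w)^β) - β/s * (w^(-s) * (1-w)^(β-1))) = -(1/s) := by
    rw [← integral_Ioc_eq_integral_Ioo, ← intervalIntegral.integral_of_le zero_le_one]
    have := intervalIntegral.integral_eq_sub_of_hasDerivAt_of_tendsto (a := 0) (b := 1)
      (f := fun w => -(w^(-s)/s) * (1 - (1-w)^β)) (f' := fun w => (w^(-1-s) * (1 - (1-w)^β) - β/s * (w^(-s) * (1-w)^(β-1))))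
      (fa := 0) (fb := -(1/s)) zero_lt_one ?_ ?_ ?_ ?_
    · rw [this]; ring
    · intro w hw
      have d1 : HasDerivAt (fun w : ℝ => w^(-s)) (-s * w^(-s-1)) w := by
        exact Real.hasDerivAt_rpow_const (Or.inl hw.1.ne')
      have d2 : HasDerivAt (fun w : ℝ => (1-w)^β) (-1 * β * (1-w)^(β-1)) w := by
        exact ((hasDerivAt_id w).const_sub 1).rpow_const (Or.inl (by simp; linarith [hw.2]))
      refine (((d1.div_const s).neg).mul (d2.const_sub 1)).congr_deriv ?_
      have : -s-1 = -1-s := by ring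
      rw [this]
      simp only [Pi.neg_apply]
      field_simp
      ring
    · rw [intervalIntegrable_iff_integrableOn_Ioo_of_le zero_le_one]
      exact i1.sub (bi.const_mul _)
    · have g : Tendsto (fun w : ℝ => (1+β)/s * w^(1-s)) (𝓝[>] 0) (𝓝 0) := by
        have c : ContinuousAt (fun w : ℝ => (1+β)/s * w^(1-s)) 0 :=
          (Real.continuousAt_rpow_const 0 (1-s) (Or.inr (by linarith))).const_mul _
        have := c.tendsto
        rw [Real.zero_rpow (by linarith), mul_zero] at this
        exact this.mono_left nhdsWithin_le_nhds
      apply squeeze_zero_norm' _ g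
      filter_upwards [Ioo_mem_nhdsGT (zero_lt_one (α := ℝ))] with w hw
      obtain ⟨a, b⟩ := bern hβ hw.1 hw.2
      have p := Real.rpow_pos_of_pos hw.1 (-s)
      have : w^(1-s) = w^(-s) * w := by
        nth_rw 3 [← Real.rpow_one w]
        rw [← Real.rpow_add hw.1]; congr 1; ring
      rw [norm_mul, norm_neg, Real.norm_of_nonneg a, Real.norm_of_nonneg (by positivity), this]
      calc w^(-s)/s * (1 - (1-w)^β) ≤ w^(-s)/s * ((1+β)*w) := by gcongr
        _ = _ := by ring
    · have c : ContinuousAt (fun w : ℝ => -(w^(-s)/s) * (1 - (1-w)^β)) 1 := by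
        apply ContinuousAt.mul
        · exact ((Real.continuousAt_rpow_const 1 (-s) (Or.inl one_ne_zero)).div_const s).neg
        · have : ContinuousAt (fun w : ℝ => (1-w)^β) 1 :=
            ContinuousAt.rpow_const (by fun_prop) (Or.inr hβ.le)
          exact this.const_sub 1
      have := c.tendsto
      simp only [sub_self, Real.zero_rpow hβ.ne', sub_zero, Real.one_rpow, mul_one] at this
      exact this.mono_left nhdsWithin_le_nhds
  rw [integral_sub i1 (bi.const_mul _), integral_const_mul, bv] at v1
  -- on Ioo 0 1
  have hk1 : ∀ w ∈ Ioo (0:ℝ) 1, w^(-1-s) * kw β w = w^(-1-s) * (1 - (1-w)^β) - w^(-s) * (1-w)^(β-1) := by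
    intro w hw
    have h1w : 0 < 1 - w := by linarith [hw.2]
    rw [kw, indicator_of_mem (by exact hw.2)]
    have e1 : w^(-s) = w^(-1-s) * w := by
      nth_rw 3 [← Real.rpow_one w]
      rw [← Real.rpow_add hw.1]; congr 1; ring
    have e2 : (1-w)^β = (1-w)^(β-1) * (1-w) := by
      nth_rw 3 [← Real.rpow_one (1-w)]
      rw [← Real.rpow_add h1w]; congr 1; ring
    rw [e1, e2]; ring
  have hk2 : ∀ w ∈ Ici (1:ℝ), w^(-1-s) * kw β w = w^(-1-s) := by
    intro w hw
    rw [kw, indicator_of_notMem (by simpa using hw)]; simp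
  have j1 : IntegrableOn (fun w : ℝ => w^(-1-s) * kw β w) (Ioo 0 1) :=
    (integrableOn_congr_fun hk1 measurableSet_Ioo).2 (i1.sub bi)
  have j2 : IntegrableOn (fun w : ℝ => w^(-1-s) * kw β w) (Ici 1) := by
    rw [integrableOn_congr_fun hk2 measurableSet_Ici, integrableOn_Ici_iff_integrableOn_Ioi]
    exact integrableOn_Ioi_rpow_of_lt (by linarith) one_pos
  have hU : Ioi (0:ℝ) = Ioo 0 1 ∪ Ici 1 := (Ioo_union_Ici_eq_Ioi one_pos).symm
  rw [hU]
  refine ⟨j1.union j2, ?_⟩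
  rw [setIntegral_union (by
      rw [Set.disjoint_left]; intro x h1 h2; exact absurd h1.2 (not_lt.2 h2)) measurableSet_Ici j1 j2,
    setIntegral_congr_fun measurableSet_Ioo hk1, setIntegral_congr_fun measurableSet_Ici hk2,
    integral_sub i1 bi, bv, integral_Ici_eq_integral_Ioi, integral_Ioi_rpow_of_lt (by linarith) one_pos]
  have : -1-s+1 = -s := by ring
  rw [this, Real.one_rpow, neg_div_neg_eq]
  linarith


lemma gam_int {a r : ℝ} (ha : 0 < a) (hr : 0 < r) :
    IntegrableOn (fun t : ℝ => t^(a-1) * Real.exp (-(r*t))) (Ioi 0) := by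
  apply Integrable.of_integral_ne_zero
  rw [Real.integral_rpow_mul_exp_neg_mul_Ioi ha hr]
  have := Real.Gamma_pos_of_pos ha
  positivity

lemma gam_val {a r : ℝ} (ha : 0 < a) (hr : 0 < r) :
    ∫ t in Ioi (0:ℝ), t^(a-1) * Real.exp (-(r*t)) = r^(-a) * Real.Gamma a := by
  rw [Real.integral_rpow_mul_exp_neg_mul_Ioi ha hr, one_div, Real.inv_rpow hr.le, Real.rpow_neg hr.le]

lemma kw_meas (β : ℝ) : Measurable (kw β) := by
  unfold kw
  apply Measurable.sub measurable_const
  apply Measurable.indicator _ measurableSet_Iio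
  fun_prop

def kR (α β t : ℝ) : ℝ := ∫ w in Ioi (0:ℝ), w^(α-1) * kw β w * Real.exp (-(w*t))

lemma kR_spec {s α β : ℝ} (hs : s ∈ Ioo (0:ℝ) 1) (hα : 0 < α) (hβ : 0 < β) :
    IntegrableOn (fun t => t^(s+α-1) * kR α β t) (Ioi 0) ∧
    ∫ t in Ioi (0:ℝ), t^(s+α-1) * kR α β t =
      Real.Gamma (s+α) * ∫ w in Ioi (0:ℝ), w^(-1-s) * kw β w := by
  have hsa : 0 < s + α := by linarith [hs.1]
  set f : ℝ → ℝ → ℝ := fun w t => w^(α-1) * kw β w * (t^(s+α-1) * Real.exp (-(w*t))) with hf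
  have hfm : Measurable (Function.uncurry f) := by
    have := kw_meas β
    simp only [hf, Function.uncurry_def]
    fun_prop
  have e0 : ∀ w ∈ Ioi (0:ℝ), w^(α-1) * kw β w * (w^(-(s+α)) * Real.Gamma (s+α)) = Real.Gamma (s+α) * (w^(-1-s) * kw β w) := by
    intro w hw
    have : w^(-1-s) = w^(α-1) * w^(-(s+α)) := by
      rw [← Real.rpow_add hw]; congr 1; ring
    rw [this]; ring
  have huncI : Integrable (Function.uncurry f) ((volume.restrict (Ioi 0)).prod (volume.restrict (Ioi 0))) := by
    rw [integrable_prod_iff hfm.aestronglyMeasurable]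
    constructor
    · filter_upwards [ae_restrict_mem measurableSet_Ioi] with w hw
      exact (gam_int hsa hw).const_mul (w^(α-1) * kw β w)
    · have := ((kw_spec hs hβ).1.norm.const_mul (Real.Gamma (s+α)))
      refine this.congr ?_
      filter_upwards [ae_restrict_mem measurableSet_Ioi] with w hw
      have : ∫ t in Ioi (0:ℝ), ‖Function.uncurry f (w, t)‖ = ∫ t in Ioi (0:ℝ), |w^(α-1) * kw β w| * (t^(s+α-1) * Real.exp (-(w*t))) := by
        apply setIntegral_congr_fun measurableSet_Ioi
        intro t ht
        have ht : 0 < t := ht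
        simp only [hf, Function.uncurry_apply_pair]
        rw [norm_mul, Real.norm_eq_abs, Real.norm_of_nonneg (by positivity)]
      have hw : 0 < w := hw
      rw [this, integral_const_mul, gam_val hsa hw]
      have h := e0 w hw
      have := congrArg abs h
      have hG := Real.Gamma_pos_of_pos hsa
      rw [abs_mul, abs_mul (Real.Gamma (s+α)), abs_of_pos hG, abs_of_pos (a := w^(-(s+α)) * Real.Gamma (s+α)) (by positivity)] at this
      rw [Real.norm_eq_abs, ← this]
  have ee : ∀ t, ∫ w in Ioi (0:ℝ), f w t = t^(s+α-1) * kR α β t := by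
    intro t
    rw [kR, ← integral_const_mul]
    congr 1; ext w; simp only [hf]; ring
  constructor
  · have := huncI.integral_prod_right
    refine this.congr (ae_of_all _ fun t => ?_)
    simp only [Function.uncurry_apply_pair]
    exact ee t
  · have := integral_integral_swap huncI
    simp_rw [ee] at this
    rw [← this, ← integral_const_mul]
    apply setIntegral_congr_fun measurableSet_Ioi
    intro w hw
    simp only [hf]
    rw [integral_const_mul, gam_val hsa hw]
    exact e0 w hw
 
lemma beta_integrable {α β : ℝ} (hα : 0 < α) (hβ : 0 < β) :
    IntegrableOn (fun w : ℝ => w^(α-1) * (1-w)^(β-1)) (Ioo 0 1) := by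
  have hc := Complex.betaIntegral_convergent (u := (α:ℂ)) (v := (β:ℂ)) (by simpa using hα) (by simpa using hβ)
  rw [intervalIntegrable_iff_integrableOn_Ioo_of_le zero_le_one] at hc
  have e : ∀ w ∈ Ioo (0:ℝ) 1, ((w:ℂ) ^ ((α:ℂ) - 1) * (1 - (w:ℂ)) ^ ((β:ℂ) - 1)).re
      = w^(α-1) * (1-w)^(β-1) := by
    intro w hw
    have a1 : ((w:ℂ) ^ ((α:ℂ) - 1)) = ((w^(α-1) : ℝ) : ℂ) := by
      rw [Complex.ofReal_cpow hw.1.le]; congr 1; push_cast; ring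
    have a2 : ((1 - (w:ℂ)) ^ ((β:ℂ) - 1)) = (((1-w)^(β-1) : ℝ) : ℂ) := by
      rw [Complex.ofReal_cpow (by linarith [hw.2])]; push_cast; rfl
    rw [a1, a2, ← Complex.ofReal_mul, Complex.ofReal_re]
  exact (integrableOn_congr_fun e measurableSet_Ioo).1 hc.re

lemma kR_eq {α β t : ℝ} (hα : 0 < α) (hβ : 0 < β) (ht : 0 < t) :
    kR α β t = t^(-α) * Real.Gamma α -
      ∫ w in Ioo (0:ℝ) 1, w^(α-1) * (1-w)^(β-1) * Real.exp (-(w*t)) := by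
  have i1 : IntegrableOn (fun w : ℝ => w^(α-1) * Real.exp (-(t*w))) (Ioi 0) := gam_int hα ht
  have i2 : IntegrableOn (fun w : ℝ => w^(α-1) * (1-w)^(β-1) * Real.exp (-(w*t))) (Ioo 0 1) := by
    refine Integrable.mono' (beta_integrable hα hβ) ?_ ?_
    · apply Measurable.aestronglyMeasurable; fun_prop
    · filter_upwards [ae_restrict_mem measurableSet_Ioo] with w hw
      have h0 : 0 < w := hw.1
      have h1 : 0 < 1-w := by linarith [hw.2]
      rw [Real.norm_of_nonneg (by positivity)]
      apply mul_le_of_le_one_right (by positivity)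
      rw [Real.exp_le_one_iff]
      nlinarith
  have i3 : IntegrableOn ((Ioo (0:ℝ) 1).indicator (fun w : ℝ => w^(α-1) * (1-w)^(β-1) * Real.exp (-(w*t)))) (Ioi 0) :=
    ((integrable_indicator_iff measurableSet_Ioo).2 i2).integrableOn
  have key : ∫ w in Ioi (0:ℝ), (Ioo (0:ℝ) 1).indicator (fun w : ℝ => w^(α-1) * (1-w)^(β-1) * Real.exp (-(w*t))) w
     = ∫ w in Ioo (0:ℝ) 1, w^(α-1) * (1-w)^(β-1) * Real.exp (-(w*t)) := by
    rw [setIntegral_indicator measurableSet_Ioo, inter_eq_right.2 Ioo_subset_Ioi_self]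
  rw [← key, ← gam_val hα ht, ← integral_sub i1 i3, kR]
  apply setIntegral_congr_fun measurableSet_Ioi
  intro w hw
  have hw : 0 < w := hw
  simp only [kw]
  by_cases h : w < 1
  · rw [indicator_of_mem (by exact h), indicator_of_mem (by exact ⟨hw, h⟩), mul_comm t w]; ring
  · rw [indicator_of_notMem (by exact h), indicator_of_notMem (by exact fun h' => h h'.2), mul_comm t w]; ring


lemma gauss_sq (N : ℕ) {e : EN N} (he : ‖e‖ = 1) {l t : ℝ} (hl : 0 ≤ l) (ht : 0 < t) (z : EN N) :
    -(l*‖z‖^2) - t * dist e z^2 = -(l+t) * ‖z - (t/(l+t)) • e‖^2 + -(l*t/(l+t)) := by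
  have h : 0 < l + t := by linarith
  have e1 : dist e z^2 = 1 - 2 * inner ℝ z e + ‖z‖^2 := by
    rw [dist_comm, dist_eq_norm, norm_sub_sq_real, he]; ring
  rw [e1, norm_sub_sq_real, inner_smul_right, norm_smul, he, mul_one, Real.norm_eq_abs, sq_abs]
  field_simp
  ring

lemma gauss_val (N : ℕ) {e : EN N} (he : ‖e‖ = 1) {l t : ℝ} (hl : 0 ≤ l) (ht : 0 < t) :
    ∫ z : EN N, Real.exp (-(l*‖z‖^2) - t * dist e z^2) =
      (Real.pi/(l+t))^((N:ℝ)/2) * Real.exp (-(l*t/(l+t))) := by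
  simp_rw [gauss_sq N he hl ht, Real.exp_add]
  rw [integral_mul_const]
  congr 1
  rw [integral_sub_right_eq_self (fun z : EN N => Real.exp (-(l+t) * ‖z‖^2)),
    GaussianFourier.integral_rexp_neg_mul_sq_norm (by linarith)]
  simp

lemma gauss_int (N : ℕ) {e : EN N} (he : ‖e‖ = 1) {t : ℝ} (ht : 0 < t) :
    Integrable (fun z : EN N => Real.exp (-(t * dist e z^2))) := by
  apply Integrable.of_integral_ne_zero
  have := gauss_val N he (le_refl 0) ht
  simp only [zero_mul, neg_zero, zero_sub, zero_add, zero_div, Real.exp_zero, mul_one] at this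
  rw [this]
  have := Real.pi_pos
  positivity

lemma gauss_val0 (N : ℕ) {e : EN N} (he : ‖e‖ = 1) {t : ℝ} (ht : 0 < t) :
    ∫ z : EN N, Real.exp (-(t * dist e z^2)) = (Real.pi/t)^((N:ℝ)/2) := by
  have := gauss_val N he (le_refl 0) ht
  simpa only [zero_mul, neg_zero, zero_sub, zero_add, zero_div, Real.exp_zero, mul_one] using this

lemma rg_int (N : ℕ) (hN : 2 ≤ N) {e : EN N} (he : ‖e‖ = 1) {t σ : ℝ} (ht : 0 < t)
    (hσ : -(N:ℝ) < σ) (hσ0 : σ < 0) :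
    Integrable (fun z : EN N => ‖z‖^σ * Real.exp (-(t * dist e z^2))) := by
  have i1 : Integrable ((ball (0:EN N) 1).indicator (fun z => ‖z‖^σ)) :=
    (integrable_indicator_iff measurableSet_ball).2 (rpow_integrableOn_ball N hN hσ 1)
  refine Integrable.mono' (i1.add (gauss_int N he ht)) ?_ ?_
  · apply Measurable.aestronglyMeasurable; fun_prop
  · filter_upwards with z
    have h0 : 0 ≤ ‖z‖^σ := by positivity
    rw [Real.norm_of_nonneg (by positivity)]
    simp only [Pi.add_apply]
    have hE : Real.exp (-(t * dist e z^2)) ≤ 1 := by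
      rw [Real.exp_le_one_iff]
      have : 0 ≤ t * dist e z^2 := by positivity
      linarith
    have hE0 := Real.exp_pos (-(t * dist e z^2))
    by_cases h : ‖z‖ < 1
    · rw [indicator_of_mem (by simpa using h)]
      nlinarith
    · rw [indicator_of_notMem (by simpa using h)]
      have : ‖z‖^σ ≤ 1 := Real.rpow_le_one_of_one_le_of_nonpos (not_lt.1 h) hσ0.le
      nlinarith

lemma cov_img {t : ℝ} (ht : 0 < t) : (fun w : ℝ => t * w / (1-w)) '' (Ioo 0 1) = Ioi 0 := by
  ext l
  constructor
  · rintro ⟨w, hw, rfl⟩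
    have : 0 < 1 - w := by linarith [hw.2]
    have := hw.1
    simp only [mem_Ioi]
    positivity
  · intro hl
    have hl : 0 < l := hl
    have : 0 < l + t := by linarith
    refine ⟨l/(l+t), ⟨by positivity, by rw [div_lt_one this]; linarith⟩, ?_⟩
    have : 1 - l/(l+t) = t/(l+t) := by field_simp; ring
    simp only [this]
    field_simp

lemma rg_val (N : ℕ) (hN : 2 ≤ N) {e : EN N} (he : ‖e‖ = 1) {t α : ℝ} (ht : 0 < t)
    (hα : 0 < α) (hα2 : 2*α < N) :
    ∫ z : EN N, ‖z‖^(-(2*α)) * Real.exp (-(t * dist e z^2)) =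
      (Real.pi/t)^((N:ℝ)/2) * (t^α / Real.Gamma α *
        ∫ w in Ioo (0:ℝ) 1, w^(α-1) * (1-w)^((N:ℝ)/2-α-1) * Real.exp (-(w*t))) := by
  have hG := Real.Gamma_pos_of_pos hα
  set f : EN N → ℝ → ℝ := fun z l => Real.exp (-(t * dist e z^2)) * (l^(α-1) * Real.exp (-(‖z‖^2*l))) with hf
  have hfm : Measurable (Function.uncurry f) := by
    simp only [hf, Function.uncurry_def]
    fun_prop
  have e0 : ∀ z : EN N, z ≠ 0 → ∫ l in Ioi (0:ℝ), f z l = Real.Gamma α * (‖z‖^(-(2*α)) * Real.exp (-(t * dist e z^2))) := by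
    intro z hz
    have hr : 0 < ‖z‖ := norm_pos_iff.2 hz
    simp only [hf]
    rw [integral_const_mul, gam_val hα (by positivity)]
    have : (‖z‖^2)^(-α) = ‖z‖^(-(2*α)) := by
      rw [← Real.rpow_natCast, ← Real.rpow_mul hr.le]; congr 1; push_cast; ring
    rw [this]; ring
  have huncI : Integrable (Function.uncurry f) (volume.prod (volume.restrict (Ioi 0))) := by
    rw [integrable_prod_iff hfm.aestronglyMeasurable]
    constructor
    · filter_upwards [ae_ne_zero N hN] with z hz
      have hr : 0 < ‖z‖ := norm_pos_iff.2 hz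
      exact (gam_int hα (r := ‖z‖^2) (by positivity)).const_mul (Real.exp (-(t * dist e z^2)))
    · refine ((rg_int N hN he ht (σ := -(2*α)) (by linarith) (by linarith)).const_mul (Real.Gamma α)).congr ?_
      filter_upwards [ae_ne_zero N hN] with z hz
      rw [← e0 z hz]
      apply setIntegral_congr_fun measurableSet_Ioi
      intro l hl
      have hl : 0 < l := hl
      simp only [Function.uncurry_apply_pair]
      rw [Real.norm_of_nonneg]
      simp only [hf]; positivity
  have sw := integral_integral_swap huncI
  have L1 : ∫ z : EN N, ∫ l in Ioi (0:ℝ), f z l = Real.Gamma α * ∫ z : EN N, ‖z‖^(-(2*α)) * Real.exp (-(t * dist e z^2)) := by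
    rw [← integral_const_mul]
    apply integral_congr_ae
    filter_upwards [ae_ne_zero N hN] with z hz using e0 z hz
  have R1 : ∫ l in Ioi (0:ℝ), ∫ z : EN N, f z l = ∫ l in Ioi (0:ℝ), l^(α-1) * ((Real.pi/(l+t))^((N:ℝ)/2) * Real.exp (-(l*t/(l+t)))) := by
    apply setIntegral_congr_fun measurableSet_Ioi
    intro l hl
    simp only []
    rw [← gauss_val N he (le_of_lt hl) ht, ← integral_const_mul]
    congr 1; ext z
    simp only [hf]
    rw [sub_eq_add_neg (-(l*‖z‖^2)), Real.exp_add, mul_comm (‖z‖^2) l]; ring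
  rw [L1, R1, ← cov_img ht, integral_image_eq_integral_abs_deriv_smul measurableSet_Ioo
    (f' := fun w => t/(1-w)^2)] at sw
  · have : ∫ z : EN N, ‖z‖^(-(2*α)) * Real.exp (-(t * dist e z^2)) =
      (Real.Gamma α)⁻¹ * (Real.Gamma α * ∫ z : EN N, ‖z‖^(-(2*α)) * Real.exp (-(t * dist e z^2))) := by
      field_simp
    rw [this, sw, ← integral_const_mul, ← mul_assoc, ← integral_const_mul]
    apply setIntegral_congr_fun measurableSet_Ioo
    intro w hw
    obtain ⟨hw0, hw1⟩ := hw
    have h1 : 0 < 1 - w := by linarith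
    have q1 : t*w/(1-w) + t = t/(1-w) := by field_simp; ring
    have q2 : t*w/(1-w)*t/(t/(1-w)) = w*t := by field_simp
    have q3 : (t*w/(1-w))^(α-1) = t^α * t⁻¹ * w^(α-1) * ((1-w) * ((1-w)^α)⁻¹) := by
      rw [Real.div_rpow (by positivity) h1.le, Real.mul_rpow ht.le hw0.le, Real.rpow_sub_one ht.ne',
        Real.rpow_sub_one h1.ne']
      field_simp
    have q4 : (Real.pi/(t/(1-w)))^((N:ℝ)/2) = (Real.pi/t)^((N:ℝ)/2) * (1-w)^((N:ℝ)/2) := by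
      rw [← Real.mul_rpow (by have := Real.pi_pos; positivity) h1.le]; congr 1; field_simp
    have q5 : (1-w)^((N:ℝ)/2-α-1) = (1-w)^((N:ℝ)/2) * ((1-w)^α)⁻¹ * (1-w)⁻¹ := by
      rw [Real.rpow_sub_one h1.ne', Real.rpow_sub h1]; field_simp
    simp only [smul_eq_mul]
    rw [q1, q2, q3, q4, q5, abs_of_pos (by positivity)]
    field_simp
  · intro w hw
    have h1 : 1 - w ≠ 0 := by linarith [hw.2]
    have d := ((hasDerivAt_id w).const_mul t).div ((hasDerivAt_id w).const_sub 1) h1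
    refine (d.congr_deriv ?_).hasDerivWithinAt
    simp only [id]
    field_simp
    ring
  · intro x hx y hy hxy
    have h1 : 1 - x ≠ 0 := by linarith [hx.2]
    have h2 : 1 - y ≠ 0 := by linarith [hy.2]
    simp only [] at hxy
    rw [div_eq_div_iff h1 h2] at hxy
    have := mul_left_cancel₀ ht.ne' (show t * x = t * y by nlinarith)
    exact this


lemma one_sub_P {N : ℕ} {t α : ℝ} (ht : 0 < t) (hα : 0 < α) (hα2 : 2*α < N) :
    t^α / Real.Gamma α * ∫ w in Ioo (0:ℝ) 1, w^(α-1) * (1-w)^((N:ℝ)/2-α-1) * Real.exp (-(w*t))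
      = 1 - t^α / Real.Gamma α * kR α ((N:ℝ)/2-α) t := by
  have hG := Real.Gamma_pos_of_pos hα
  rw [kR_eq hα (by linarith) ht, Real.rpow_neg ht.le]
  have : 0 < t^α := Real.rpow_pos_of_pos ht _
  generalize (∫ w in Ioo (0:ℝ) 1, w^(α-1) * (1-w)^((N:ℝ)/2-α-1) * Real.exp (-(w*t))) = Q
  field_simp
  ring

lemma Ifold_mid_eq (N : ℕ) (hN : 2 ≤ N) (s : ℝ) (hs : s ∈ Ioo (0:ℝ) 1) :
    Real.Gamma (((N:ℝ)+2*s)/2) * (2 * Ifold N s ((2*s-N)/2)) =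
      Real.pi^((N:ℝ)/2) * (2 / Real.Gamma (((N:ℝ)-2*s)/4) * (Real.Gamma (((N:ℝ)+2*s)/4) *
        ((((N:ℝ)+2*s)/4/s - 1) * (Real.Gamma (1-s) * Real.Gamma (((N:ℝ)+2*s)/4) /
          Real.Gamma (1-s+((N:ℝ)+2*s)/4))))) := by
  obtain ⟨hs0, hs1⟩ := id hs
  have hN' : (2:ℝ) ≤ N := by exact_mod_cast hN
  have he := norm_e1 N hN
  have hpi := Real.pi_pos
  obtain ⟨Ui, Uv⟩ := U_spec N hN s hs
  rw [← Uv]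
  set m := (2*s-N)/2 with hm
  set b := (N:ℝ)+2*s with hb
  have hb2 : 0 < b/2 := by rw [hb]; linarith
  set f : EN N → ℝ → ℝ := fun z t => (1-‖z‖^m)^2 * (t^(b/2-1) * Real.exp (-(dist (e1 N) z^2*t))) with hf
  have hfm : Measurable (Function.uncurry f) := by
    simp only [hf, Function.uncurry_def]
    fun_prop
  have hne : ∀ᵐ z : EN N, z ≠ e1 N := by
    have := EN_nontrivial N hN
    exact compl_mem_ae_iff.2 (measure_singleton (e1 N))
  have e0 : ∀ z : EN N, z ≠ e1 N → ∫ t in Ioi (0:ℝ), f z t = Real.Gamma (b/2) * ((1-‖z‖^m)^2 / dist (e1 N) z ^ b) := by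
    intro z hz
    have hr : 0 < dist (e1 N) z := dist_pos.2 hz.symm
    simp only [hf]
    rw [integral_const_mul, gam_val hb2 (by positivity)]
    have : (dist (e1 N) z^2)^(-(b/2)) = (dist (e1 N) z ^ b)⁻¹ := by
      rw [← Real.rpow_natCast, ← Real.rpow_mul hr.le, ← Real.rpow_neg hr.le]; congr 1; push_cast; ring
    rw [this]; ring
  have huncI : Integrable (Function.uncurry f) (volume.prod (volume.restrict (Ioi 0))) := by
    rw [integrable_prod_iff hfm.aestronglyMeasurable]
    constructor
    · filter_upwards [hne] with z hz
      have hr : 0 < dist (e1 N) z := dist_pos.2 hz.symm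
      exact (gam_int hb2 (r := dist (e1 N) z^2) (by positivity)).const_mul ((1-‖z‖^m)^2)
    · refine (Ui.const_mul (Real.Gamma (b/2))).congr ?_
      filter_upwards [hne] with z hz
      rw [← e0 z hz]
      apply setIntegral_congr_fun measurableSet_Ioi
      intro l hl
      have hl : 0 < l := hl
      simp only [Function.uncurry_apply_pair]
      rw [Real.norm_of_nonneg]
      simp only [hf]; positivity
  have sw := integral_integral_swap huncI
  have L1 : ∫ z : EN N, ∫ t in Ioi (0:ℝ), f z t = Real.Gamma (b/2) * ∫ z : EN N, (1-‖z‖^m)^2 / dist (e1 N) z ^ b := by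
    rw [← integral_const_mul]
    apply integral_congr_ae
    filter_upwards [hne] with z hz using e0 z hz
  set α1 := ((N:ℝ)-2*s)/4 with hα1
  set β1 := ((N:ℝ)+2*s)/4 with hβ1
  set α2 := ((N:ℝ)-2*s)/2 with hα2
  have p1 : 0 < α1 := by rw [hα1]; linarith
  have p2 : 0 < α2 := by rw [hα2]; linarith
  have p3 : 0 < β1 := by rw [hβ1]; linarith
  have hb1 : (N:ℝ)/2 - α1 = β1 := by rw [hα1, hβ1]; ring
  have hb2' : (N:ℝ)/2 - α2 = s := by rw [hα2]; ring
  have R1 : ∀ t ∈ Ioi (0:ℝ), ∫ z : EN N, f z t =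
     Real.pi^((N:ℝ)/2) * (2 / Real.Gamma α1 * (t^(s+α1-1) * kR α1 β1 t) -
      1 / Real.Gamma α2 * (t^(s+α2-1) * kR α2 s t)) := by
    intro t ht
    have ht : 0 < t := ht
    have j0 := gauss_int N he ht
    have j1 := rg_int N hN he ht (σ := -(2*α1)) (by rw [hα1]; linarith) (by linarith)
    have j2 := rg_int N hN he ht (σ := -(2*α2)) (by rw [hα2]; linarith) (by linarith)
    have v1 := rg_val N hN he ht p1 (by rw [hα1]; linarith)
    have v2 := rg_val N hN he ht p2 (by rw [hα2]; linarith)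
    rw [one_sub_P ht p1 (by rw [hα1]; linarith), hb1] at v1
    rw [one_sub_P ht p2 (by rw [hα2]; linarith), hb2'] at v2
    have v0 := gauss_val0 N he ht
    have : ∫ z : EN N, f z t = ∫ z : EN N, t^(b/2-1) * (Real.exp (-(t * dist (e1 N) z^2))
        - 2 * (‖z‖^(-(2*α1)) * Real.exp (-(t * dist (e1 N) z^2)))
        + ‖z‖^(-(2*α2)) * Real.exp (-(t * dist (e1 N) z^2))) := by
      apply integral_congr_ae
      filter_upwards [ae_ne_zero N hN] with z hz
      have hr : 0 < ‖z‖ := norm_pos_iff.2 hz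
      have x1 : ‖z‖^(-(2*α1)) = ‖z‖^m := by congr 1; rw [hα1, hm]; ring
      have x2 : ‖z‖^(-(2*α2)) = (‖z‖^m)^2 := by
        rw [sq, ← Real.rpow_add hr]; congr 1; rw [hα2, hm]; ring
      simp only [hf]
      rw [x1, x2, mul_comm t]; ring
    have j3 : Integrable (fun z : EN N => Real.exp (-(t * dist (e1 N) z^2))
        - 2 * (‖z‖^(-(2*α1)) * Real.exp (-(t * dist (e1 N) z^2)))) := j0.sub (j1.const_mul 2)
    rw [this, integral_const_mul, integral_add j3 j2, integral_sub j0 (j1.const_mul 2),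
      integral_const_mul, v0, v1, v2]
    have y1 : t^(s+α1-1) = t^(s-1) * t^α1 := by rw [← Real.rpow_add ht]; congr 1; ring
    have y2 : t^(s+α2-1) = t^(s-1) * t^α2 := by rw [← Real.rpow_add ht]; congr 1; ring
    have y3 : t^(b/2-1) * (Real.pi/t)^((N:ℝ)/2) = Real.pi^((N:ℝ)/2) * t^(s-1) := by
      have : t^(b/2-1) = t^(s-1) * t^((N:ℝ)/2) := by rw [← Real.rpow_add ht]; congr 1; rw [hb]; ring
      have q := Real.rpow_pos_of_pos ht ((N:ℝ)/2)
      rw [Real.div_rpow hpi.le ht.le, this]; field_simp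
    rw [y1, y2]
    linear_combination (2 * (t^α1 / Real.Gamma α1 * kR α1 β1 t) - t^α2 / Real.Gamma α2 * kR α2 s t) * y3
  obtain ⟨k1i, k1v⟩ := kR_spec hs p1 p3
  obtain ⟨k2i, k2v⟩ := kR_spec hs p2 hs0
  rw [L1, setIntegral_congr_fun measurableSet_Ioi R1, integral_const_mul,
    integral_sub (k1i.const_mul _) (k2i.const_mul _), integral_const_mul, integral_const_mul, k1v, k2v,
    (kw_spec hs p3).2, (kw_spec hs hs0).2] at sw
  rw [sw]
  have : s + α1 = β1 := by rw [hα1, hβ1]; ring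
  rw [this, div_self hs0.ne']
  ring

lemma Ifold_mid (N : ℕ) (hN : 2 ≤ N) (s : ℝ) (hs : s ∈ Ioo (0:ℝ) 1) :
    CNs N s * Ifold N s ((2*s-N)/2) = - mu0 N s := by
  obtain ⟨hs0, hs1⟩ := id hs
  have hN' : (2:ℝ) ≤ N := by exact_mod_cast hN
  have h := Ifold_mid_eq N hN s hs
  have hpi := Real.pi_pos
  have g1 := Real.Gamma_pos_of_pos (show 0 < ((N:ℝ)+2*s)/2 by linarith)
  have ha : 0 < ((N:ℝ)-2*s)/4 := by linarith
  have g2 := Real.Gamma_pos_of_pos ha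
  have g3 := Real.Gamma_pos_of_pos (show 0 < 1 - s by linarith)
  have e1 : 1 - s + ((N:ℝ)+2*s)/4 = ((N:ℝ)-2*s)/4 + 1 := by ring
  have e2 : ((N:ℝ)+2*s)/4/s - 1 = ((N:ℝ)-2*s)/4 / s := by field_simp; ring
  rw [e1, e2, Real.Gamma_add_one ha.ne'] at h
  unfold CNs mu0
  have e3 : Real.pi^(-(N:ℝ)/2) = (Real.pi^((N:ℝ)/2))⁻¹ := by rw [← Real.rpow_neg hpi.le]; congr 1; ring
  have g4 : 0 < Real.pi^((N:ℝ)/2) := by positivity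
  rw [e3]
  set P := Real.pi^((N:ℝ)/2)
  set Gb := Real.Gamma (((N:ℝ)+2*s)/2)
  set Ga := Real.Gamma (((N:ℝ)-2*s)/4)
  set Gβ := Real.Gamma (((N:ℝ)+2*s)/4)
  set G1 := Real.Gamma (1-s)
  set α := ((N:ℝ)-2*s)/4
  set I := Ifold N s ((2*s-N)/2)
  have h' : Gb * I = P * (Gβ^2 * G1 / (s * Ga^2)) := by
    have : P * (2 / Ga * (Gβ * (α / s * (G1 * Gβ / (α * Ga))))) = 2 * (P * (Gβ^2 * G1 / (s * Ga^2))) := by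
      field_simp
    linarith
  calc 2^(2*s) * P⁻¹ * s * Gb / G1 * I = 2^(2*s) * P⁻¹ * s / G1 * (Gb * I) := by ring
    _ = _ := by rw [h', neg_neg]; field_simp


def phiF (N : ℕ) (s τ : ℝ) : ℝ := -(CNs N s * Ifold N s τ)

lemma pow_lap (N : ℕ) (hN : 2 ≤ N) (s : ℝ) (hs : s ∈ Ioo (0:ℝ) 1) {τ : ℝ}
    (hτ : τ ∈ Ioo (-(N:ℝ)) (2*s)) {x : EN N} (hx : x ≠ 0) :
    HasFracLap N s (fun z : EN N => ‖z‖^τ) x (-(phiF N s τ / ‖x‖^(2*s)) * ‖x‖^τ) := by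
  have h := fpq_hasFracLap N hN s hs hτ 1 0 hx
  rw [pow_eq_fpq]
  convert h using 1
  rw [Real.rpow_sub (norm_pos_iff.2 hx), phiF]; ring

lemma lap_unique (N : ℕ) (hN : 2 ≤ N) (s : ℝ) (hs : s ∈ Ioo (0:ℝ) 1) {τ : ℝ}
    (hτ : τ ∈ Ioo (-(N:ℝ)) (2*s)) {p q L : ℝ}
    (h : HasFracLap N s (fun z : EN N => fpq τ p q ‖z‖) (e1 N) L) :
    L = CNs N s * (p * Ifold N s τ + q * Jfold N s τ) := by
  have he := norm_e1 N hN
  have hx : e1 N ≠ 0 := by rw [← norm_pos_iff, he]; exact one_pos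
  have h2 := fpq_hasFracLap N hN s hs hτ p q hx
  have := tendsto_nhds_unique h h2
  rw [this, he]; simp

lemma pow_unique (N : ℕ) (hN : 2 ≤ N) (s : ℝ) (hs : s ∈ Ioo (0:ℝ) 1) {τ μ : ℝ}
    (hτ : τ ∈ Ioo (-(N:ℝ)) (2*s))
    (h : ∀ x : EN N, x ≠ 0 → HasFracLap N s (fun z : EN N => ‖z‖^τ) x (-(μ / ‖x‖^(2*s)) * ‖x‖^τ)) :
    phiF N s τ = μ := by
  have he := norm_e1 N hN
  have hx : e1 N ≠ 0 := by rw [← norm_pos_iff, he]; exact one_pos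
  have h1 := h _ hx
  rw [pow_eq_fpq, he] at h1
  have := lap_unique N hN s hs hτ h1
  simp at this
  rw [phiF]; linarith

lemma phi_exists (N : ℕ) (hN : 2 ≤ N) (s : ℝ) (hs : s ∈ Ioo (0:ℝ) 1) {μ : ℝ} (hμ : mu0 N s ≤ μ) :
    ∃ τ ∈ Ico ((2*s-(N:ℝ))/2) (2*s), phiF N s τ = μ := by
  have hm := mid_mem N hN s hs
  have hC := CNs_pos N s hs
  obtain ⟨τ1, h1, h2⟩ := Ifold_unbdd N hN s hs (-(μ / CNs N s))
  have hc : ContinuousOn (phiF N s) (Icc ((2*s-(N:ℝ))/2) τ1) := by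
    have := Ifold_cont N hN s hs
    refine ((this.const_smul (CNs N s)).neg).mono ?_
    intro x hx
    exact ⟨by linarith [hx.1], lt_of_le_of_lt hx.2 h1.2⟩
  have := intermediate_value_Icc (by linarith [h1.1]) hc (show μ ∈ Icc _ _ from ⟨?_, ?_⟩)
  · obtain ⟨τ, hτ, e⟩ := this
    exact ⟨τ, ⟨hτ.1, lt_of_le_of_lt hτ.2 h1.2⟩, e⟩
  · rw [phiF, Ifold_mid N hN s hs]; linarith
  · rw [phiF]
    have : CNs N s * Ifold N s τ1 ≤ CNs N s * (-(μ / CNs N s)) := by gcongr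
    have e : CNs N s * (-(μ / CNs N s)) = -μ := by field_simp
    linarith

/-- Proposition A: existence and uniqueness of the exponents `τ₋(s,μ)` and
`τ₊(s,μ)` such that `Φ_μ` and `Γ_μ` are classical solutions of the fractional Hardy
equation, together with the monotonicity, continuity and asymptotic properties. -/
theorem radial_solutions_fractional_hardy
    (N : ℕ) (hN : 2 ≤ N) (s : ℝ) (hs : s ∈ Ioo (0:ℝ) 1) :
    ∃ τm τp : ℝ → ℝ,
      (∀ μ : ℝ, mu0 N s ≤ μ →
        (τm μ ∈ Ioc (-(N:ℝ)) ((2*s - N)/2) ∧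
         MemL1w N s (Phi N s μ (τm μ)) ∧
         ContDiffOn ℝ (⊤ : ℕ∞) (Phi N s μ (τm μ)) {(0:EN N)}ᶜ ∧
         (∀ x : EN N, x ≠ 0 →
            HasFracLap N s (Phi N s μ (τm μ)) x (-(μ / ‖x‖ ^ (2*s)) * Phi N s μ (τm μ) x)) ∧
         (∀ τ ∈ Ioc (-(N:ℝ)) ((2*s - N)/2),
            (MemL1w N s (Phi N s μ τ) ∧ ContDiffOn ℝ (⊤ : ℕ∞) (Phi N s μ τ) {(0:EN N)}ᶜ ∧
             ∀ x : EN N, x ≠ 0 →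
               HasFracLap N s (Phi N s μ τ) x (-(μ / ‖x‖ ^ (2*s)) * Phi N s μ τ x)) →
            τ = τm μ) ∧
         τp μ ∈ Ico ((2*s - N)/2) (2*s) ∧
         MemL1w N s (fun x : EN N => ‖x‖ ^ τp μ) ∧
         ContDiffOn ℝ (⊤ : ℕ∞) (fun x : EN N => ‖x‖ ^ τp μ) {(0:EN N)}ᶜ ∧
         (∀ x : EN N, x ≠ 0 →
            HasFracLap N s (fun y : EN N => ‖y‖ ^ τp μ) x (-(μ / ‖x‖ ^ (2*s)) * ‖x‖ ^ τp μ)) ∧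
         (∀ τ ∈ Ico ((2*s - N)/2) (2*s),
            (MemL1w N s (fun x : EN N => ‖x‖ ^ τ) ∧
             ContDiffOn ℝ (⊤ : ℕ∞) (fun x : EN N => ‖x‖ ^ τ) {(0:EN N)}ᶜ ∧
             ∀ x : EN N, x ≠ 0 →
               HasFracLap N s (fun y : EN N => ‖y‖ ^ τ) x (-(μ / ‖x‖ ^ (2*s)) * ‖x‖ ^ τ)) →
            τ = τp μ))) ∧
      ContinuousOn τm (Ici (mu0 N s)) ∧ StrictAntiOn τm (Ici (mu0 N s)) ∧
      ContinuousOn τp (Ici (mu0 N s)) ∧ StrictMonoOn τp (Ici (mu0 N s)) ∧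
      (∀ μ : ℝ, mu0 N s ≤ μ → τm μ + τp μ = 2*s - N) ∧
      τm (mu0 N s) = (2*s - N)/2 ∧ τp (mu0 N s) = (2*s - N)/2 ∧
      τm 0 = 2*s - N ∧ τp 0 = 0 ∧
      Tendsto τm atTop (𝓝 (-(N:ℝ))) ∧ Tendsto τp atTop (𝓝 (2*s)) := by
  have hm := mid_mem N hN s hs
  have hC := CNs_pos N s hs
  obtain ⟨hs0, hs1⟩ := id hs
  have hN' : (2:ℝ) ≤ N := by exact_mod_cast hN
  have hex : ∀ μ : ℝ, ∃ τ : ℝ, mu0 N s ≤ μ → (τ ∈ Ico ((2*s-(N:ℝ))/2) (2*s) ∧ phiF N s τ = μ) := by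
    intro μ
    by_cases h : mu0 N s ≤ μ
    · obtain ⟨τ, h1, h2⟩ := phi_exists N hN s hs h
      exact ⟨τ, fun _ => ⟨h1, h2⟩⟩
    · exact ⟨0, fun h' => absurd h' h⟩
  choose τp hτp using hex
  have hmono : StrictMonoOn (phiF N s) (Ico ((2*s-(N:ℝ))/2) (2*s)) := by
    intro x hx y hy hxy
    have := mul_lt_mul_of_pos_left (Ifold_anti N hN s hs hx hy hxy) hC
    simp only [phiF]; linarith
  have hmid : phiF N s ((2*s-N)/2) = mu0 N s := by rw [phiF, Ifold_mid N hN s hs, neg_neg]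
  have hzero : phiF N s 0 = 0 := by rw [phiF, Ifold_zero]; simp
  have hmidmem : (2*s-(N:ℝ))/2 ∈ Ico ((2*s-(N:ℝ))/2) (2*s) := ⟨le_rfl, by linarith⟩
  have hzmem : (0:ℝ) ∈ Ico ((2*s-(N:ℝ))/2) (2*s) := ⟨by linarith, by linarith⟩
  have hge : ∀ τ ∈ Ico ((2*s-(N:ℝ))/2) (2*s), mu0 N s ≤ phiF N s τ := by
    intro τ hτ
    rw [← hmid]
    exact hmono.monotoneOn hmidmem hτ hτ.1
  have hinv : ∀ τ ∈ Ico ((2*s-(N:ℝ))/2) (2*s), τp (phiF N s τ) = τ := by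
    intro τ hτ
    obtain ⟨a, b⟩ := hτp _ (hge τ hτ)
    exact hmono.injOn a hτ b
  have hlt1 : ∀ μ, mu0 N s ≤ μ → ∀ τ ∈ Ico ((2*s-(N:ℝ))/2) (2*s), (phiF N s τ < μ ↔ τ < τp μ) := by
    intro μ hμ τ hτ
    obtain ⟨a, b⟩ := hτp _ hμ
    rw [← hmono.lt_iff_lt hτ a, b]
  have hlt2 : ∀ μ, mu0 N s ≤ μ → ∀ τ ∈ Ico ((2*s-(N:ℝ))/2) (2*s), (μ < phiF N s τ ↔ τp μ < τ) := by
    intro μ hμ τ hτ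
    obtain ⟨a, b⟩ := hτp _ hμ
    rw [← hmono.lt_iff_lt a hτ, b]
  have hsm : StrictMonoOn τp (Ici (mu0 N s)) := by
    intro x hx y hy hxy
    obtain ⟨a, b⟩ := hτp x hx
    rw [← hlt1 y hy _ a, b]; exact hxy
  have hcont : ContinuousOn τp (Ici (mu0 N s)) := by
    intro μ hμ
    obtain ⟨a, b⟩ := hτp μ hμ
    refine tendsto_order.2 ⟨?_, ?_⟩
    · intro c hc
      by_cases h : c < (2*s-(N:ℝ))/2
      · filter_upwards [self_mem_nhdsWithin] with ν hν
        exact lt_of_lt_of_le h (hτp ν hν).1.1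
      · have hcm : c ∈ Ico ((2*s-(N:ℝ))/2) (2*s) := ⟨not_lt.1 h, hc.trans a.2⟩
        have := (hlt1 μ hμ c hcm).2 hc
        filter_upwards [self_mem_nhdsWithin, mem_nhdsWithin_of_mem_nhds (Ioi_mem_nhds this)] with ν hν h2
        exact (hlt1 ν hν c hcm).1 h2
    · intro c hc
      by_cases h : 2*s ≤ c
      · filter_upwards [self_mem_nhdsWithin] with ν hν
        exact lt_of_lt_of_le (hτp ν hν).1.2 h
      · have hcm : c ∈ Ico ((2*s-(N:ℝ))/2) (2*s) := ⟨a.1.trans hc.le, not_le.1 h⟩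
        have := (hlt2 μ hμ c hcm).2 hc
        filter_upwards [self_mem_nhdsWithin, mem_nhdsWithin_of_mem_nhds (Iio_mem_nhds this)] with ν hν h2
        exact (hlt2 ν hν c hcm).1 h2
  have hlim : Tendsto τp atTop (𝓝 (2*s)) := by
    refine tendsto_order.2 ⟨?_, ?_⟩
    · intro c hc
      have hcm : max c ((2*s-(N:ℝ))/2) ∈ Ico ((2*s-(N:ℝ))/2) (2*s) :=
        ⟨le_max_right _ _, max_lt hc (by linarith)⟩
      filter_upwards [eventually_ge_atTop (mu0 N s), eventually_gt_atTop (phiF N s (max c ((2*s-(N:ℝ))/2)))] with ν hν h2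
      exact lt_of_le_of_lt (le_max_left _ _) ((hlt1 ν hν _ hcm).1 h2)
    · intro c hc
      filter_upwards [eventually_ge_atTop (mu0 N s)] with ν hν
      exact (hτp ν hν).1.2.trans hc
  have hsym : ∀ τ, phiF N s (2*s-N-τ) = phiF N s τ := by
    intro τ; rw [phiF, phiF, Ifold_symm]
  have hp0 : τp (mu0 N s) = (2*s-N)/2 := by
    have := hinv _ hmidmem
    rwa [hmid] at this
  have hpz : τp 0 = 0 := by
    have := hinv _ hzmem
    rwa [hzero] at this
  refine ⟨fun μ => 2*s-N-τp μ, τp, ?_, ?_, ?_, hcont, hsm, ?_, ?_, hp0, ?_, hpz, ?_, hlim⟩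
  · intro μ hμ
    obtain ⟨a, b⟩ := hτp μ hμ
    have hmI : 2*s-N-τp μ ∈ Ioc (-(N:ℝ)) ((2*s - N)/2) := ⟨by linarith [a.2], by linarith [a.1]⟩
    have hpo : ∀ τ ∈ Ico ((2*s-(N:ℝ))/2) (2*s), τ ∈ Ioo (-(N:ℝ)) (2*s) :=
      fun τ h => ⟨by linarith [h.1], h.2⟩
    have hmo : ∀ τ ∈ Ioc (-(N:ℝ)) ((2*s - N)/2), τ ∈ Ioo (-(N:ℝ)) (2*s) :=
      fun τ h => ⟨h.1, by linarith [h.2]⟩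
    refine ⟨hmI, ?_, ?_, ?_, ?_, a, rpow_memL1w N hN s hs (hpo _ a), ?_, ?_, ?_⟩
    · by_cases h : μ = mu0 N s
      · subst h; rw [Phi_eq_mu0]; exact fpq_memL1w N hN s hs (hmo _ hmI) _ _
      · rw [Phi_eq_ne N s _ h]; exact fpq_memL1w N hN s hs (hmo _ hmI) _ _
    · by_cases h : μ = mu0 N s
      · subst h; rw [Phi_eq_mu0]; exact fpq_contDiffOn N _ _ _
      · rw [Phi_eq_ne N s _ h]; exact fpq_contDiffOn N _ _ _
    · intro x hx
      by_cases h : μ = mu0 N s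
      · subst h
        have hτ : 2*s-N-τp (mu0 N s) = (2*s-N)/2 := by rw [hp0]; ring
        beta_reduce
        rw [hτ] at hmI ⊢
        rw [Phi_eq_mu0]
        convert fpq_hasFracLap N hN s hs (hmo _ hmI) 0 (-1) hx using 1
        rw [Jfold_mid, ← hmid, phiF, Real.rpow_sub (norm_pos_iff.2 hx)]
        simp only [fpq]
        ring
      · rw [Phi_eq_ne N s _ h, ← pow_eq_fpq]
        have := pow_lap N hN s hs (hmo _ hmI) hx
        rwa [hsym, b] at this
    · rintro τ hτ ⟨-, -, h3⟩
      by_cases h : μ = mu0 N s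
      · subst h
        rw [Phi_eq_mu0] at h3
        have he := norm_e1 N hN
        have hx : e1 N ≠ 0 := by rw [← norm_pos_iff, he]; exact one_pos
        have h4 := lap_unique N hN s hs (hmo _ hτ) (h3 _ hx)
        beta_reduce at h4
        rw [he, fpq_one] at h4
        have h5 : Jfold N s τ = 0 := by
          have : CNs N s * Jfold N s τ = 0 := by linarith
          exact (mul_eq_zero.1 this).resolve_left hC.ne'
        beta_reduce
        rw [hp0]
        by_contra hne
        have : τ < (2*s-N)/2 := lt_of_le_of_ne hτ.2 (fun h => hne (by rw [h]; ring))
        exact (Jfold_pos N hN s hs hτ.1 this).ne' h5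
      · rw [Phi_eq_ne N s _ h, ← pow_eq_fpq] at h3
        have h4 := pow_unique N hN s hs (hmo _ hτ) h3
        have : 2*s-N-τ ∈ Ico ((2*s-(N:ℝ))/2) (2*s) := ⟨by linarith [hτ.2], by linarith [hτ.1]⟩
        have := hinv _ this
        rw [hsym, h4] at this
        beta_reduce
        linarith
    · rw [pow_eq_fpq]; exact fpq_contDiffOn N _ _ _
    · intro x hx
      have := pow_lap N hN s hs (hpo _ a) hx
      rwa [b] at this
    · rintro τ hτ ⟨-, -, h3⟩
      have h4 := pow_unique N hN s hs (hpo _ hτ) h3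
      rw [← h4, hinv τ hτ]
  · exact continuousOn_const.sub hcont
  · intro x hx y hy hxy
    have := hsm hx hy hxy
    simp only []; linarith
  · intro μ _; ring
  · simp only [hp0]; ring
  · simp only [hpz]; ring
  · have := hlim.const_sub (2*s-(N:ℝ))
    convert this using 2; ring
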